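/- arXiv:2210.07112 — 3 statements merged into one kernel-verified Lean document; each statement's English description precedes it below -/
import Mathlib

section
/- The combinatorial higher q,t-Catalan numbers are jointly symmetric: for all integers m, n ≥ 1 and all natural numbers u, v, the number of vectors a ∈ L with dinv_m(a) = u and area_m(a) = v equals the number of vectors a ∈ L with dinv_m(a) = v and area_m(a) = u. Equivalently, C_n^{(m)}(q,t) = ∑_{a ∈ L} q^{dinv_m(a)} t^{area_m(a)} satisfies C_n^{(m)}(q,t) = C_n^{(m)}(t,q). -/
open Finset

/-- `sc_m : ℤ → ℤ`. -/
def scm (m : ℕ) (p : ℤ) : ℤ :=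
  if 1 ≤ p ∧ p ≤ (m : ℤ) then (m : ℤ) + 1 - p
  else if -(m : ℤ) ≤ p ∧ p ≤ 0 then (m : ℤ) + p
  else 0

/-- `dinv_m(a) = ∑_{0 ≤ i < j ≤ n-1} sc_m(a_i - a_j)` for `a ∈ ℤ^n`. -/
def dinvm (n m : ℕ) (a : Fin n → ℤ) : ℤ :=
  ∑ j : Fin n, ∑ i ∈ Finset.univ.filter (· < j), scm m (a i - a j)

/-- `area_m(a) = ∑_{i=0}^{n-1} a_i` for `a ∈ ℤ^n`. -/
def aream (n : ℕ) (a : Fin n → ℤ) : ℤ := ∑ i, a i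


namespace QT
open MvPolynomial

set_option linter.unusedSectionVars false

section ops
variable {k : Type*} [CommRing k]

/-- swap of two variables -/
noncomputable def sw (i j : ℕ) : MvPolynomial ℕ k →ₐ[k] MvPolynomial ℕ k :=
  rename (Equiv.swap i j)

lemma sw_X (i j a : ℕ) : sw i j (X a : MvPolynomial ℕ k) = X (Equiv.swap i j a) := by
  simp [sw]

lemma sw_sw (i j : ℕ) (f : MvPolynomial ℕ k) : sw i j (sw i j f) = f := by
  have : (sw i j).comp (sw i j) = AlgHom.id k (MvPolynomial ℕ k) := by
    ext a; simp [sw_X]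
  exact DFunLike.congr_fun this f

lemma dvd_sub_sw (i j : ℕ) (f : MvPolynomial ℕ k) :
    (X i - X j : MvPolynomial ℕ k) ∣ f - sw i j f := by
  induction f using MvPolynomial.induction_on with
  | C a => simp [sw]
  | add p r hp hr =>
    have : p + r - sw i j (p + r) = (p - sw i j p) + (r - sw i j r) := by rw [map_add]; ring
    rw [this]; exact dvd_add hp hr
  | mul_X p a hp =>
    have : p * X a - sw i j (p * X a) = (p - sw i j p) * X a + sw i j p * (X a - sw i j (X a)) := by
      rw [map_mul]; ring
    rw [this]
    refine dvd_add (Dvd.dvd.mul_right hp _) (Dvd.dvd.mul_left ?_ _)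
    rw [sw_X]
    by_cases h1 : a = i
    · subst h1; simp
    · by_cases h2 : a = j
      · subst h2; rw [Equiv.swap_apply_right]; exact ⟨-1, by ring⟩
      · rw [Equiv.swap_apply_of_ne_of_ne h1 h2]; simp

/-- divided difference -/
noncomputable def dd (i j : ℕ) (f : MvPolynomial ℕ k) : MvPolynomial ℕ k :=
  (dvd_sub_sw i j f).choose

lemma dd_spec (i j : ℕ) (f : MvPolynomial ℕ k) :
    f - sw i j f = (X i - X j) * dd i j f := (dvd_sub_sw i j f).choose_spec

/-- Demazure-Lusztig operator -/
noncomputable def TT (q : k) (i j : ℕ) (f : MvPolynomial ℕ k) : MvPolynomial ℕ k :=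
  sw i j f + C (q - 1) * dd i j (X i * f)

lemma TT_spec (q : k) (i j : ℕ) (f : MvPolynomial ℕ k) :
    (X i - X j) * TT q i j f = (X i - C q * X j) * sw i j f + C (q - 1) * (X i * f) := by
  have := dd_spec i j (X i * f)
  rw [map_mul, sw_X, Equiv.swap_apply_left] at this
  unfold TT
  rw [mul_add, mul_left_comm, ← this]
  simp only [map_sub, map_one]; ring

lemma X_sub_ne [Nontrivial k] {i j : ℕ} (h : i ≠ j) : (X i - X j : MvPolynomial ℕ k) ≠ 0 := by
  rw [sub_ne_zero]; intro e; exact h (X_injective e)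

variable [IsDomain k] (q : k)

lemma TT_unique {i j : ℕ} (h : i ≠ j) {f g : MvPolynomial ℕ k}
    (e : (X i - X j) * g = (X i - C q * X j) * sw i j f + C (q - 1) * (X i * f)) :
    TT q i j f = g := by
  apply mul_left_cancel₀ (X_sub_ne h)
  rw [TT_spec, e]

lemma TT_add {i j : ℕ} (h : i ≠ j) (f g : MvPolynomial ℕ k) :
    TT q i j (f + g) = TT q i j f + TT q i j g := by
  apply TT_unique q h
  rw [mul_add, TT_spec, TT_spec, map_add]; ring

lemma TT_mul_sym {i j : ℕ} (h : i ≠ j) (f g : MvPolynomial ℕ k) (hg : sw i j g = g) :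
    TT q i j (g * f) = g * TT q i j f := by
  apply TT_unique q h
  rw [mul_left_comm, TT_spec, map_mul, hg]; ring

lemma sw_C (i j : ℕ) (c : k) : sw i j (C c) = C c := by simp [sw]

lemma TT_C {i j : ℕ} (h : i ≠ j) (c : k) (f : MvPolynomial ℕ k) :
    TT q i j (C c * f) = C c * TT q i j f := TT_mul_sym q h _ _ (sw_C i j c)

lemma TT_zero {i j : ℕ} (h : i ≠ j) : TT q i j (0 : MvPolynomial ℕ k) = 0 := by
  apply TT_unique q h; simp

lemma TT_sum {i j : ℕ} (h : i ≠ j) {ι : Type*} (s : Finset ι) (f : ι → MvPolynomial ℕ k) :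
    TT q i j (∑ a ∈ s, f a) = ∑ a ∈ s, TT q i j (f a) := by
  classical
  induction s using Finset.induction_on with
  | empty => simpa using TT_zero q h
  | insert a s ha ih => rw [sum_insert ha, sum_insert ha, TT_add q h, ih]

lemma TT_sym {i j : ℕ} (h : i ≠ j) (f : MvPolynomial ℕ k) (hf : sw i j f = f) :
    TT q i j f = C q * f := by
  apply TT_unique q h; rw [hf]; simp only [map_sub, map_one]; ring

/-- commutation with homs -/
lemma TT_hom {k' : Type*} [CommRing k'] [IsDomain k'] (q' : k') {i j i' j' : ℕ}
    (h' : i' ≠ j')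
    (φ : MvPolynomial ℕ k →+* MvPolynomial ℕ k')
    (hC : φ (C q) = C q') (hi : φ (X i) = X i') (hj : φ (X j) = X j')
    (hs : ∀ f, φ (sw i j f) = sw i' j' (φ f)) (f : MvPolynomial ℕ k) :
    φ (TT q i j f) = TT q' i' j' (φ f) := by
  symm
  apply TT_unique q' h'
  have := congrArg φ (TT_spec q i j f)
  simp only [map_mul, map_add, map_sub, hC, hi, hj, hs, map_one] at this ⊢
  exact this

lemma sw_comm {i j a b : ℕ} (h1 : i ≠ a) (h2 : i ≠ b) (h3 : j ≠ a) (h4 : j ≠ b)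
    (f : MvPolynomial ℕ k) : sw i j (sw a b f) = sw a b (sw i j f) := by
  have : (sw i j).comp (sw a b) = ((sw a b).comp (sw i j) : MvPolynomial ℕ k →ₐ[k] _) := by
    apply MvPolynomial.algHom_ext; intro c
    simp only [AlgHom.comp_apply, sw_X]
    congr 1
    simp only [Equiv.swap_apply_def]
    split_ifs <;> omega
  exact DFunLike.congr_fun this f

lemma TT_comm {i j a b : ℕ} (h : i ≠ j) (h1 : i ≠ a) (h2 : i ≠ b) (h3 : j ≠ a) (h4 : j ≠ b)
    (hab : a ≠ b) (f : MvPolynomial ℕ k) :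
    TT q i j (TT q a b f) = TT q a b (TT q i j f) := by
  apply TT_unique q h
  apply mul_left_cancel₀ (X_sub_ne (k := k) hab)
  have e1 := TT_spec q a b f
  have e2 := TT_spec q i j f
  have e3 := TT_spec q a b (TT q i j f)
  have e4 := congrArg (sw i j) e1
  have e5 := congrArg (sw a b) e2
  simp only [map_mul, map_add, map_sub, sw_X, sw_C, map_one,
    Equiv.swap_apply_of_ne_of_ne h1.symm h3.symm, Equiv.swap_apply_of_ne_of_ne h2.symm h4.symm,
    Equiv.swap_apply_of_ne_of_ne h1 h2, Equiv.swap_apply_of_ne_of_ne h3 h4] at *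
  rw [sw_comm h1 h2 h3 h4] at e4
  linear_combination (X i - X j) * e3 + (X a - C q * X b) * e5 + (C q - 1) * X a * e2
    - (X i - C q * X j) * e4 - (C q - 1) * X i * e1

lemma sw_braid {a b c : ℕ} (h1 : a ≠ b) (h2 : b ≠ c) (h3 : a ≠ c) (f : MvPolynomial ℕ k) :
    sw a b (sw b c (sw a b f)) = sw b c (sw a b (sw b c f)) := by
  have : (sw a b).comp ((sw b c).comp (sw a b)) =
      ((sw b c).comp ((sw a b).comp (sw b c)) : MvPolynomial ℕ k →ₐ[k] _) := by
    apply MvPolynomial.algHom_ext; intro d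
    simp only [AlgHom.comp_apply, sw_X]
    congr 1
    simp only [Equiv.swap_apply_def]
    split_ifs <;> omega
  exact DFunLike.congr_fun this f

lemma TT_braid {a b c : ℕ} (h1 : a ≠ b) (h2 : b ≠ c) (h3 : a ≠ c) (f : MvPolynomial ℕ k) :
    TT q a b (TT q b c (TT q a b f)) = TT q b c (TT q a b (TT q b c f)) := by
  have p1 : (X a - X b : MvPolynomial ℕ k) ≠ 0 := X_sub_ne h1
  have p2 : (X b - X c : MvPolynomial ℕ k) ≠ 0 := X_sub_ne h2
  have p3 : (X a - X c : MvPolynomial ℕ k) ≠ 0 := X_sub_ne h3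
  have a1 := TT_spec q a b f
  have a2 := TT_spec q b c (TT q a b f)
  have a3 := TT_spec q a b (TT q b c (TT q a b f))
  have a4 := congrArg (sw b c) a1
  have a5 := congrArg (sw a b) a2
  have a6 := congrArg (sw a b) a4
  have a7 := congrArg (sw a b) a1
  have b1 := TT_spec q b c f
  have b2 := TT_spec q a b (TT q b c f)
  have b3 := TT_spec q b c (TT q a b (TT q b c f))
  have b4 := congrArg (sw a b) b1
  have b5 := congrArg (sw b c) b2
  have b6 := congrArg (sw b c) b4
  have b7 := congrArg (sw b c) b1
  simp only [map_mul, map_add, map_sub, sw_X, sw_C, map_one, sw_sw,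
    Equiv.swap_apply_of_ne_of_ne h1 h3, Equiv.swap_apply_of_ne_of_ne h3.symm h2.symm,
    Equiv.swap_apply_left, Equiv.swap_apply_right] at a1 a2 a3 a4 a5 a6 a7 b1 b2 b3 b4 b5 b6 b7
  rw [← sw_braid h1 h2 h3] at b6
  generalize TT q a b (TT q b c (TT q a b f)) = w at *
  generalize TT q b c (TT q a b (TT q b c f)) = w' at *
  generalize sw a b (TT q b c (TT q a b f)) = s1v at *
  generalize sw b c (TT q a b (TT q b c f)) = s1v' at *
  generalize (TT q b c (TT q a b f)) = v at *
  generalize (TT q a b (TT q b c f)) = v' at *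
  generalize sw a b (sw b c (TT q a b f)) = s12u at *
  generalize sw b c (sw a b (TT q b c f)) = s12u' at *
  generalize sw a b (TT q a b f) = s1u at *
  generalize sw b c (TT q a b f) = s2u at *
  generalize sw a b (TT q b c f) = s1u' at *
  generalize sw b c (TT q b c f) = s2u' at *
  generalize TT q a b f = u at *
  generalize TT q b c f = u' at *
  generalize sw a b (sw b c (sw a b f)) = f0 at *
  generalize sw a b (sw b c f) = f12 at *
  generalize sw b c (sw a b f) = f21 at *
  generalize sw a b f = f1 at *
  generalize sw b c f = f2 at *
  generalize (X a : MvPolynomial ℕ k) = x at *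
  generalize (X b : MvPolynomial ℕ k) = y at *
  generalize (X c : MvPolynomial ℕ k) = z at *
  generalize (C q : MvPolynomial ℕ k) = Q at *
  have A1 : (x - z) * (y - z) * (x - y) * s1v = (x - y) * (x - Q * z) * ((y - Q * z) * f0
      + (Q - 1) * (y * f12)) - (y - z) * (Q - 1) * x * ((y - Q * x) * f + (Q - 1) * (y * f1)) := by
    linear_combination (x - y) * (y - z) * a5 + (x - y) * (x - Q * z) * a6
      - (y - z) * (Q - 1) * x * a7
  have A2 : (x - z) * (y - z) * (x - y) * v = (x - y) * (y - Q * z) * ((x - Q * z) * f21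
      + (Q - 1) * (x * f2)) + (x - z) * (Q - 1) * y * ((x - Q * y) * f1 + (Q - 1) * (x * f)) := by
    linear_combination (x - z) * (x - y) * a2 + (x - y) * (y - Q * z) * a4
      + (x - z) * (Q - 1) * y * a1
  have B1 : (x - z) * (y - z) * (x - y) * s1v' = (y - z) * (x - Q * z) * ((x - Q * y) * f0
      + (Q - 1) * (x * f21)) - (x - y) * (Q - 1) * x * ((z - Q * y) * f + (Q - 1) * (z * f2)) := by
    linear_combination (x - y) * (y - z) * b5 + (y - z) * (x - Q * z) * b6
      - (x - y) * (Q - 1) * x * b7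
  have B2 : (x - z) * (y - z) * (x - y) * v' = (y - z) * (x - Q * y) * ((x - Q * z) * f12
      + (Q - 1) * (x * f1)) + (x - z) * (Q - 1) * x * ((y - Q * z) * f2 + (Q - 1) * (y * f)) := by
    linear_combination (x - z) * (y - z) * b2 + (y - z) * (x - Q * y) * b4
      + (x - z) * (Q - 1) * x * b1
  apply mul_left_cancel₀ (mul_ne_zero (mul_ne_zero (mul_ne_zero p1 p1) (mul_ne_zero p2 p2)) p3)
  linear_combination (x - z) * (y - z) ^ 2 * (x - y) * a3 + (y - z) * ((x - Q * y) * A1 + (Q - 1) * x * A2)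
   - (x - z) * (y - z) * (x - y) ^ 2 * b3 - (x - y) * ((y - Q * z) * B1 + (Q - 1) * y * B2)

end ops
end QT


namespace QT
open MvPolynomial
set_option linter.unusedSectionVars false

/-- adjacent swap on exponents -/
def sq (i : ℕ) (β : ℕ → ℕ) : ℕ → ℕ := fun a => β (Equiv.swap i (i+1) a)

lemma sq_left (i : ℕ) (β : ℕ → ℕ) : sq i β i = β (i+1) := by simp [sq]
lemma sq_right (i : ℕ) (β : ℕ → ℕ) : sq i β (i+1) = β i := by simp [sq]
lemma sq_ne {i a : ℕ} (h1 : a ≠ i) (h2 : a ≠ i+1) (β : ℕ → ℕ) : sq i β a = β a := by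
  simp [sq, Equiv.swap_apply_of_ne_of_ne h1 h2]
lemma sq_apply (i a : ℕ) (β : ℕ → ℕ) :
    sq i β a = if a = i then β (i+1) else if a = i+1 then β i else β a := by
  simp only [sq, Equiv.swap_apply_def]; split_ifs <;> rfl
lemma sq_sq (i : ℕ) (β : ℕ → ℕ) : sq i (sq i β) = β := by
  funext a; simp [sq]
lemma sq_comm {i j : ℕ} (h : i + 1 < j ∨ j + 1 < i) (β : ℕ → ℕ) :
    sq i (sq j β) = sq j (sq i β) := by
  funext a; simp only [sq_apply]; split_ifs <;> first | rfl | omega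
lemma sq_braid (i : ℕ) (β : ℕ → ℕ) :
    sq i (sq (i+1) (sq i β)) = sq (i+1) (sq i (sq (i+1) β)) := by
  funext a; simp only [sq_apply]; split_ifs <;> first | rfl | omega

/-- termination measure -/
def mu (n : ℕ) (β : ℕ → ℕ) : ℕ := ∑ i ∈ range n, (n - i) * β i

lemma mu_lt {n i : ℕ} {β : ℕ → ℕ} (hi : i + 1 < n) (hd : β (i+1) < β i) :
    mu n (sq i β) < mu n β := by
  unfold mu
  have hi1 : i ∈ range n := by simp; omega
  have hi2 : i + 1 ∈ (range n).erase i := by simp; omega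
  rw [← add_sum_erase _ _ hi1, ← add_sum_erase _ _ hi2,
    ← add_sum_erase (range n) (fun i => (n - i) * β i) hi1,
    ← add_sum_erase _ (fun i => (n - i) * β i) hi2]
  have : ∑ x ∈ ((range n).erase i).erase (i+1), (n - x) * sq i β x
      = ∑ x ∈ ((range n).erase i).erase (i+1), (n - x) * β x := by
    apply sum_congr rfl; intro x hx
    simp only [mem_erase] at hx
    rw [sq_ne hx.2.1 hx.1]
  rw [this, sq_left, sq_right]
  obtain ⟨r, hr⟩ : ∃ r, n - i = r + 1 := ⟨n - i - 1, by omega⟩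
  have hr2 : n - (i+1) = r := by omega
  rw [hr, hr2]
  nlinarith

section FF
variable {k : Type*} [CommRing k]

/-- monomial -/
noncomputable def ym (n : ℕ) (β : ℕ → ℕ) : MvPolynomial ℕ k := ∏ i ∈ range n, X i ^ β i

/-- basis -/
noncomputable def F (q : k) (n : ℕ) (β : ℕ → ℕ) : MvPolynomial ℕ k :=
  open Classical in
  if h : ∃ i, i + 1 < n ∧ β (i+1) < β i then
    TT q h.choose (h.choose + 1) (F q n (sq h.choose β)) else ym n β
termination_by mu n β
decreasing_by exact mu_lt h.choose_spec.1 h.choose_spec.2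

/-- no descents -/
def Srt (n : ℕ) (β : ℕ → ℕ) : Prop := ∀ i, i + 1 < n → β i ≤ β (i+1)

lemma Srt.le {n : ℕ} {β : ℕ → ℕ} (h : Srt n β) {i j : ℕ} (hij : i ≤ j) (hj : j < n) :
    β i ≤ β j := by
  induction j, hij using Nat.le_induction with
  | base => exact le_rfl
  | succ m hm ih => exact (ih (by omega)).trans (h m hj)

lemma F_srt (q : k) {n : ℕ} {β : ℕ → ℕ} (h : Srt n β) : F q n β = ym n β := by
  rw [F, dif_neg]; rintro ⟨i, h1, h2⟩; have := h i h1; omega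

lemma F_desc (q : k) {n : ℕ} {β : ℕ → ℕ} (h : ¬ Srt n β) :
    ∃ i, i + 1 < n ∧ β (i+1) < β i ∧ F q n β = TT q i (i+1) (F q n (sq i β)) := by
  have h' : ∃ i, i + 1 < n ∧ β (i+1) < β i := by
    unfold Srt at h; push Not at h; exact h
  refine ⟨h'.choose, h'.choose_spec.1, h'.choose_spec.2, ?_⟩
  conv_lhs => rw [F]
  rw [dif_pos h']

lemma F_ind (n : ℕ) {P : (ℕ → ℕ) → Prop} (h0 : ∀ β, Srt n β → P β)
    (h1 : ∀ β i, i + 1 < n → β (i+1) < β i → (∀ β', mu n β' < mu n β → P β') → P β) (β : ℕ → ℕ) :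
    P β := by
  induction hm : mu n β using Nat.strong_induction_on generalizing β with
  | _ N ih =>
    by_cases h : Srt n β
    · exact h0 β h
    · unfold Srt at h; push Not at h
      obtain ⟨i, hi, hd⟩ := h
      exact h1 β i hi hd (fun β' hβ' => ih _ (hm ▸ hβ') β' rfl)

variable [IsDomain k] (q : k)

lemma F_T (n : ℕ) (β : ℕ → ℕ) : ∀ j, j + 1 < n → β (j+1) < β j →
    F q n β = TT q j (j+1) (F q n (sq j β)) := by
  induction hm : mu n β using Nat.strong_induction_on generalizing β with
  | _ N ih =>
  intro j hj hd
  have hns : ¬ Srt n β := by intro h; have := h j hj; omega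
  obtain ⟨i, hi, hid, hF⟩ := F_desc q hns
  have IH : ∀ β', mu n β' < mu n β → ∀ j, j + 1 < n → β' (j+1) < β' j →
    F q n β' = TT q j (j+1) (F q n (sq j β')) := fun β' h => ih _ (hm ▸ h) β' rfl
  clear ih
  have mi := mu_lt hi hid
  have mj := mu_lt hj hd
  rw [hF]
  by_cases hij : i = j
  · subst hij; rfl
  by_cases hadj : i + 1 = j
  · subst hadj
    have d1 : sq i β (i+1+1) < sq i β (i+1) := by
      rw [sq_right, sq_ne (by omega) (by omega)]; omega
    have d2 : sq (i+1) (sq i β) (i+1) < sq (i+1) (sq i β) i := by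
      simp only [sq_apply]; split_ifs <;> omega
    have d3 : sq (i+1) β (i+1) < sq (i+1) β i := by
      simp only [sq_apply]; split_ifs <;> omega
    have d4 : sq i (sq (i+1) β) (i+1+1) < sq i (sq (i+1) β) (i+1) := by
      simp only [sq_apply]; split_ifs <;> omega
    rw [IH _ mi (i+1) hj d1, IH _ ((mu_lt hj d1).trans mi) i hi d2,
      IH _ mj i hi d3, IH _ ((mu_lt hi d3).trans mj) (i+1) hj d4, sq_braid,
      TT_braid q (by omega) (by omega) (by omega)]
  by_cases hadj2 : j + 1 = i
  · subst hadj2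
    have d1 : sq j β (j+1+1) < sq j β (j+1) := by
      rw [sq_right, sq_ne (by omega) (by omega)]; omega
    have d2 : sq (j+1) (sq j β) (j+1) < sq (j+1) (sq j β) j := by
      simp only [sq_apply]; split_ifs <;> omega
    have d3 : sq (j+1) β (j+1) < sq (j+1) β j := by
      simp only [sq_apply]; split_ifs <;> omega
    have d4 : sq j (sq (j+1) β) (j+1+1) < sq j (sq (j+1) β) (j+1) := by
      simp only [sq_apply]; split_ifs <;> omega
    rw [IH _ mj (j+1) hi d1, IH _ ((mu_lt hi d1).trans mj) j hj d2,
      IH _ mi j hj d3, IH _ ((mu_lt hj d3).trans mi) (j+1) hi d4, sq_braid,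
      TT_braid q (by omega) (by omega) (by omega)]
  · have d1 : sq i β (j+1) < sq i β j := by
      rw [sq_ne (by omega) (by omega), sq_ne (by omega) (by omega)]; exact hd
    have d2 : sq j β (i+1) < sq j β i := by
      rw [sq_ne (by omega) (by omega), sq_ne (by omega) (by omega)]; exact hid
    rw [IH _ mi j hj d1, IH _ mj i hi d2, sq_comm (by omega),
      TT_comm q (by omega) (by omega) (by omega) (by omega) (by omega) (by omega)]

lemma F_T' {n : ℕ} {β : ℕ → ℕ} {j : ℕ} (hj : j + 1 < n) (hd : β j < β (j+1)) :
    TT q j (j+1) (F q n β) = F q n (sq j β) := by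
  rw [F_T q n (sq j β) j hj (by rw [sq_left, sq_right]; exact hd), sq_sq]

lemma sw_ym (n i : ℕ) (hi : i + 1 < n) (β : ℕ → ℕ) :
    sw i (i+1) (ym n β : MvPolynomial ℕ k) = ym n (sq i β) := by
  unfold ym
  rw [map_prod]
  refine prod_bij' (fun a _ => Equiv.swap i (i+1) a) (fun a _ => Equiv.swap i (i+1) a) ?_ ?_ ?_ ?_ ?_
  · intro a ha; simp only [mem_range, Equiv.swap_apply_def] at *; split_ifs <;> omega
  · intro a ha; simp only [mem_range, Equiv.swap_apply_def] at *; split_ifs <;> omega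
  · intro a ha; simp
  · intro a ha; simp
  · intro a ha; simp [sw_X, sq]

lemma sq_tie {i : ℕ} {β : ℕ → ℕ} (h : β i = β (i+1)) : sq i β = β := by
  funext a; rw [sq_apply]; split_ifs <;> simp_all

lemma F_tie (n : ℕ) (β : ℕ → ℕ) : ∀ i, i + 1 < n → β i = β (i+1) →
    TT q i (i+1) (F q n β) = C q * F q n β := by
  induction β using F_ind n with
  | h0 β h =>
    intro i hi he
    rw [F_srt q h, TT_sym q (by omega)]
    rw [sw_ym n i hi, sq_tie he]
  | h1 β j hj hd IH =>
    intro i hi he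
    have mj := mu_lt hj hd
    rw [F_T q n β j hj hd]
    by_cases hij : i = j
    · subst hij; omega
    by_cases ha : i + 1 = j
    · subst ha
      have d3 : sq (i+1) β (i+1) < sq (i+1) β i := by
        simp only [sq_apply]; split_ifs <;> omega
      have d4 : sq i (sq (i+1) β) (i+1) = sq i (sq (i+1) β) (i+1+1) := by
        simp only [sq_apply]; split_ifs <;> omega
      rw [F_T q n _ i hi d3, TT_braid q (by omega) (by omega) (by omega),
        IH _ ((mu_lt hi d3).trans mj) (i+1) hj d4, TT_C q (by omega), TT_C q (by omega)]
    by_cases ha : j + 1 = i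
    · subst ha
      have d3 : sq j β (j+1+1) < sq j β (j+1) := by
        simp only [sq_apply]; split_ifs <;> omega
      have d4 : sq (j+1) (sq j β) j = sq (j+1) (sq j β) (j+1) := by
        simp only [sq_apply]; split_ifs <;> omega
      rw [F_T q n _ (j+1) hi d3, ← TT_braid q (by omega) (by omega) (by omega),
        IH _ ((mu_lt hi d3).trans mj) j hj d4, TT_C q (by omega), TT_C q (by omega)]
    · have d4 : sq j β i = sq j β (i+1) := by
        rw [sq_ne (by omega) (by omega), sq_ne (by omega) (by omega)]; exact he
      rw [TT_comm q (by omega) (by omega) (by omega) (by omega) (by omega) (by omega),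
        IH _ mj i hi d4, TT_C q (by omega)]

lemma TT_ym {n i : ℕ} (hi : i + 1 < n) {β : ℕ → ℕ} (h : β (i+1) = β i + 1) :
    TT q i (i+1) (ym n β : MvPolynomial ℕ k) = ym n (sq i β) := by
  have hi1 : i ∈ range n := by simp; omega
  have hi2 : i + 1 ∈ (range n).erase i := by simp; omega
  apply TT_unique q (by omega)
  rw [sw_ym n i hi]
  have key : (X i : MvPolynomial ℕ k) * ym n β = X (i+1) * ym n (sq i β) := by
    unfold ym
    rw [← mul_prod_erase _ _ hi1, ← mul_prod_erase _ _ hi2,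
      ← mul_prod_erase (range n) (fun j => (X j : MvPolynomial ℕ k) ^ sq i β j) hi1,
      ← mul_prod_erase _ (fun j => (X j : MvPolynomial ℕ k) ^ sq i β j) hi2]
    have : ∏ x ∈ ((range n).erase i).erase (i+1), (X x : MvPolynomial ℕ k) ^ sq i β x
      = ∏ x ∈ ((range n).erase i).erase (i+1), X x ^ β x := by
      apply prod_congr rfl; intro x hx
      simp only [mem_erase] at hx
      rw [sq_ne hx.2.1 hx.1]
    rw [this, sq_left, sq_right, h]; ring
  rw [key]; simp only [map_sub, map_one]; ring

lemma F_near (n : ℕ) (β : ℕ → ℕ) : (∀ i j, i < j → j < n → β i ≤ β j + 1) →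
    F q n β = ym n β := by
  induction β using F_ind n with
  | h0 β h => intro _; exact F_srt q h
  | h1 β j hj hd IH =>
    intro h
    have hj1 := h j (j+1) (by omega) hj
    rw [F_T q n β j hj hd, IH _ (mu_lt hj hd), TT_ym q hj, sq_sq]
    · rw [sq_left, sq_right]; omega
    · intro a b hab hb
      have t1 := h a b hab hb
      have t2 := h a (j+1)
      have t3 := h a j
      have t4 := h j b
      have t5 := h (j+1) b
      simp only [sq_apply]
      split_ifs <;> subst_vars <;> omega

lemma F_congr (n : ℕ) (β : ℕ → ℕ) : ∀ β' : ℕ → ℕ, (∀ i < n, β i = β' i) →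
    F q n β = F q n β' := by
  induction β using F_ind n with
  | h0 β h =>
    intro β' e
    rw [F_srt q h, F_srt q (β := β')]
    · unfold ym; apply prod_congr rfl; intro i hi; rw [e i (by simpa using hi)]
    · intro i hi; rw [← e i (by omega), ← e (i+1) hi]; exact h i hi
  | h1 β j hj hd IH =>
    intro β' e
    rw [F_T q n β j hj hd, F_T q n β' j hj (by rw [← e j (by omega), ← e (j+1) hj]; exact hd),
      IH _ (mu_lt hj hd) (sq j β')]
    intro i hi
    simp only [sq_apply]
    rw [e i hi, e j (by omega), e (j+1) hj]

lemma ym_add (n : ℕ) (β γ : ℕ → ℕ) :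
    (ym n (fun i => β i + γ i) : MvPolynomial ℕ k) = ym n β * ym n γ := by
  simp [ym, pow_add, prod_mul_distrib]

lemma F_shift (n M : ℕ) (β : ℕ → ℕ) :
    F q n (fun i => β i + M) = ym n (fun _ => M) * F q n β := by
  induction β using F_ind n with
  | h0 β h =>
    rw [F_srt q h, F_srt q, ym_add, mul_comm]
    intro i hi; have := h i hi; show β i + M ≤ β (i+1) + M; omega
  | h1 β j hj hd IH =>
    have : sq j (fun i => β i + M) = fun i => sq j β i + M := rfl
    rw [F_T q n β j hj hd, F_T q n _ j hj (by simpa using hd), this, IH _ (mu_lt hj hd),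
      TT_mul_sym q (by omega)]
    rw [sw_ym n j hj]; rfl

end FF
end QT


namespace QT
open MvPolynomial
set_option linter.unusedSectionVars false

lemma sum_swap {M : Type*} [AddCommMonoid M] {n i : ℕ} (hi : i + 1 < n) (f : ℕ → M) :
    ∑ a ∈ range n, f (Equiv.swap i (i+1) a) = ∑ a ∈ range n, f a := by
  refine sum_bij' (fun a _ => Equiv.swap i (i+1) a) (fun a _ => Equiv.swap i (i+1) a) ?_ ?_ ?_ ?_ ?_
  · intro a ha; simp only [mem_range, Equiv.swap_apply_def] at *; split_ifs <;> omega
  · intro a ha; simp only [mem_range, Equiv.swap_apply_def] at *; split_ifs <;> omega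
  · intro a ha; simp
  · intro a ha; simp
  · intro a ha; simp

/-- sum over pairs -/
def ps (n : ℕ) (g : ℕ → ℕ → ℕ) : ℕ :=
  ∑ a ∈ range n, ∑ l ∈ range n, if a < l then g a l else 0

lemma ps_congr {n : ℕ} {g g' : ℕ → ℕ → ℕ} (h : ∀ a l, a < l → l < n → g a l = g' a l) :
    ps n g = ps n g' := by
  unfold ps
  refine sum_congr rfl fun a ha => sum_congr rfl fun l hl => ?_
  split_ifs with hh
  · exact h a l hh (by simpa using hl)
  · rfl

lemma ps_swap {n i : ℕ} (hi : i + 1 < n) (g : ℕ → ℕ → ℕ) :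
    ps n (fun a l => g (Equiv.swap i (i+1) a) (Equiv.swap i (i+1) l)) + g i (i+1)
      = ps n g + g (i+1) i := by
  have e1 : ps n (fun a l => g (Equiv.swap i (i+1) a) (Equiv.swap i (i+1) l))
      = ∑ a ∈ range n, ∑ l ∈ range n,
        if Equiv.swap i (i+1) a < Equiv.swap i (i+1) l then g a l else 0 := by
    unfold ps
    rw [← sum_swap hi]
    refine sum_congr rfl fun a _ => ?_
    rw [← sum_swap hi]
    refine sum_congr rfl fun l _ => ?_
    simp
  have e2 : ∀ b c, b < n → c < n → g b c = ∑ a ∈ range n, ∑ l ∈ range n,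
      if a = b ∧ l = c then g a l else 0 := by
    intro b c hb hc
    rw [sum_eq_single b, sum_eq_single c]
    · simp
    · intro x _ hx; simp [hx]
    · intro h; simp at h; omega
    · intro x _ hx; simp [hx]
    · intro h; simp at h; omega
  rw [e1, e2 i (i+1) (by omega) hi, e2 (i+1) i hi (by omega)]
  unfold ps
  simp only [← sum_add_distrib]
  refine sum_congr rfl fun a _ => sum_congr rfl fun l _ => ?_
  simp only [Equiv.swap_apply_def]
  split_ifs <;> omega

/-- indicator -/
def ind (R : Finset ℕ) : ℕ → ℕ := fun i => if i ∈ R then 1 else 0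

/-- e-Pieri exponent -/
def wt (n : ℕ) (R : Finset ℕ) (β : ℕ → ℕ) : ℕ :=
  ps n (fun a l => if β a = β l + 1 ∧ a ∉ R ∧ l ∈ R then 1 else 0)

/-- swapped subset -/
def swS (i : ℕ) (R : Finset ℕ) : Finset ℕ := R.map (Equiv.swap i (i+1)).toEmbedding

lemma mem_swS {i a : ℕ} {R : Finset ℕ} : a ∈ swS i R ↔ Equiv.swap i (i+1) a ∈ R := by
  unfold swS; rw [mem_map_equiv, Equiv.symm_swap]

lemma swS_swS (i : ℕ) (R : Finset ℕ) : swS i (swS i R) = R := by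
  ext a; simp [mem_swS]

lemma card_swS (i : ℕ) (R : Finset ℕ) : #(swS i R) = #R := by simp [swS]

lemma swS_mem {n i : ℕ} (hi : i + 1 < n) {R : Finset ℕ} (hR : R ∈ (range n).powerset) :
    swS i R ∈ (range n).powerset := by
  rw [mem_powerset] at *
  intro a ha; rw [mem_swS] at ha
  have := hR ha
  simp only [mem_range, Equiv.swap_apply_def] at *; split_ifs at this <;> omega

lemma ind_swS (i : ℕ) (R : Finset ℕ) : ind (swS i R) = sq i (ind R) := by
  funext a; simp [ind, sq, mem_swS]

lemma sum_swS {M : Type*} [AddCommMonoid M] {n i : ℕ} (hi : i + 1 < n) (f : Finset ℕ → M) :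
    ∑ R ∈ (range n).powerset, f (swS i R) = ∑ R ∈ (range n).powerset, f R :=
  sum_bij' (fun R _ => swS i R) (fun R _ => swS i R) (fun _ h => swS_mem hi h)
    (fun _ h => swS_mem hi h) (fun _ _ => swS_swS _ _) (fun _ _ => swS_swS _ _) (fun _ _ => rfl)

section
variable {k : Type*} [CommRing k] [IsDomain k] (q : k)

/-- generating elementary symmetric polynomial -/
noncomputable def es (ψ : ℕ → k) (n : ℕ) : MvPolynomial ℕ k :=
  ∑ R ∈ (range n).powerset, C (ψ #R) * ym n (ind R)

lemma sw_es (ψ : ℕ → k) {n i : ℕ} (hi : i + 1 < n) : sw i (i+1) (es ψ n) = es ψ n := by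
  unfold es
  rw [map_sum, ← sum_swS hi]
  refine sum_congr rfl fun R _ => ?_
  rw [map_mul, sw_C, sw_ym _ _ hi, card_swS, ind_swS, sq_sq]

lemma e_pieri (ψ : ℕ → k) (n : ℕ) (β : ℕ → ℕ) :
    es ψ n * F q n β = ∑ R ∈ (range n).powerset,
      C (ψ #R * q ^ wt n R β) * F q n (fun i => β i + ind R i) := by
  induction β using F_ind n with
  | h0 β h =>
    rw [F_srt q h, es, sum_mul]
    refine sum_congr rfl fun R _ => ?_
    rw [F_near q, ym_add]
    · have : wt n R β = 0 := by
        unfold wt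
        have : ps n (fun a l => if β a = β l + 1 ∧ a ∉ R ∧ l ∈ R then 1 else 0)
            = ps n (fun _ _ => 0) := by
          apply ps_congr; intro a l hal hl
          have := h.le hal.le hl
          rw [if_neg]; omega
        rw [this]; simp [ps]
      rw [this]; simp; ring
    · intro a b hab hb
      have := h.le hab.le hb
      simp only [ind]; split_ifs <;> omega
  | h1 β i hi hd IH =>
    rw [F_T q n β i hi hd, ← TT_mul_sym q (by omega) _ _ (sw_es ψ hi), IH _ (mu_lt hi hd),
      TT_sum q (by omega), ← sum_swS hi]
    refine sum_congr rfl fun R _ => ?_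
    rw [TT_C q (by omega), card_swS]
    have hw := ps_swap hi (fun a l => if β a = β l + 1 ∧ a ∉ R ∧ l ∈ R then 1 else 0)
    have e1 : ps n (fun a l => (fun a l => if β a = β l + 1 ∧ a ∉ R ∧ l ∈ R then 1 else 0)
        (Equiv.swap i (i+1) a) (Equiv.swap i (i+1) l)) = wt n (swS i R) (sq i β) := by
      unfold wt; congr 1; funext a l; simp only [mem_swS]; rfl
    rw [e1] at hw
    change _ = wt n R β + _ at hw
    have e2 : (fun j => sq i β j + ind (swS i R) j) = sq i (fun j => β j + ind R j) := by
      rw [ind_swS]; rfl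
    rw [e2]
    have h2 : ¬ (β (i+1) = β i + 1 ∧ i + 1 ∉ R ∧ i ∈ R) := by omega
    simp only [if_neg h2, add_zero] at hw
    by_cases ht : β i = β (i+1) + 1 ∧ i ∉ R ∧ i + 1 ∈ R
    · rw [if_pos ht] at hw
      have te : β i + ind R i = β (i+1) + ind R (i+1) := by simp [ind, ht]
      have te' : sq i (fun j => β j + ind R j) = fun j => β j + ind R j :=
        sq_tie (β := fun j => β j + ind R j) te
      rw [te', F_tie q n _ i hi te, ← hw, pow_succ]
      simp only [map_mul]; ring
    · rw [if_neg ht, add_zero] at hw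
      rw [F_T' q hi, sq_sq, hw]
      rw [sq_left, sq_right]
      by_cases r1 : i ∈ R <;> by_cases r2 : i + 1 ∈ R <;> simp [ind, r1, r2] at ht ⊢ <;> omega

lemma ym_succ_rename (n : ℕ) (b : ℕ → ℕ) :
    (ym (n+1) (fun i => if i = 0 then 0 else b (i-1)) : MvPolynomial ℕ k)
      = rename Nat.succ (ym n b) := by
  unfold ym
  rw [prod_range_succ']; simp

lemma F_cons (n : ℕ) (b : ℕ → ℕ) :
    F q (n+1) (fun i => if i = 0 then 0 else b (i-1)) = rename Nat.succ (F q n b) := by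
  induction b using F_ind n with
  | h0 b h =>
    rw [F_srt q h, F_srt q, ym_succ_rename]
    intro i hi
    rcases i with _ | i
    · simp
    · simpa using h i (by omega)
  | h1 b i hi hd IH =>
    rw [F_T q n b i hi hd, F_T q _ _ (i+1) (by omega) (by simpa using hd)]
    have e : sq (i+1) (fun i => if i = 0 then 0 else b (i-1))
        = fun j => if j = 0 then 0 else sq i b (j-1) := by
      funext j
      rcases j with _ | j
      · simp [sq_apply]
      · simp only [sq_apply]; simp
    rw [e, IH _ (mu_lt hi hd)]
    symm
    refine TT_hom q q (by omega) (rename Nat.succ : MvPolynomial ℕ k →ₐ[k] _).toRingHom ?_ ?_ ?_ ?_ _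
    · simp
    · simp
    · simp
    · intro f
      have : (rename Nat.succ : MvPolynomial ℕ k →ₐ[k] _).comp (sw i (i+1))
          = (sw (i+1) (i+1+1)).comp (rename Nat.succ) := by
        apply MvPolynomial.algHom_ext; intro c
        simp only [AlgHom.comp_apply, sw_X, rename_X]
        congr 1
        simp only [Equiv.swap_apply_def]
        split_ifs <;> omega
      exact DFunLike.congr_fun this f

/-- set `y_j = 0` and relabel -/
noncomputable def Ev (j : ℕ) : MvPolynomial ℕ k →ₐ[k] MvPolynomial ℕ k :=
  aeval (fun i => if i < j then X i else if i = j then 0 else X (i-1))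

lemma Ev_X (j i : ℕ) : Ev j (X i : MvPolynomial ℕ k)
    = if i < j then X i else if i = j then 0 else X (i-1) := by simp [Ev]

lemma Ev_T_lt {i j : ℕ} (h : i + 1 < j) (f : MvPolynomial ℕ k) :
    Ev j (TT q i (i+1) f) = TT q i (i+1) (Ev j f) := by
  refine TT_hom q q (by omega) (Ev j : MvPolynomial ℕ k →ₐ[k] _).toRingHom ?_ ?_ ?_ ?_ _
  · simp [Ev]
  · simp only [AlgHom.toRingHom_eq_coe, RingHom.coe_coe, Ev_X]; rw [if_pos (by omega)]
  · simp only [AlgHom.toRingHom_eq_coe, RingHom.coe_coe, Ev_X]; rw [if_pos (by omega)]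
  · intro f
    have : (Ev j : MvPolynomial ℕ k →ₐ[k] _).comp (sw i (i+1)) = (sw i (i+1)).comp (Ev j) := by
      apply MvPolynomial.algHom_ext; intro c
      simp only [AlgHom.comp_apply, sw_X, Ev_X, Equiv.swap_apply_def]
      split_ifs <;> first | omega | simp [sw_X, Equiv.swap_apply_def] <;> (try split_ifs) <;> first | omega | rfl
    exact DFunLike.congr_fun this f

lemma Ev_T_gt {i j : ℕ} (h : j < i) (f : MvPolynomial ℕ k) :
    Ev j (TT q i (i+1) f) = TT q (i-1) i (Ev j f) := by
  refine TT_hom q q (by omega) (Ev j : MvPolynomial ℕ k →ₐ[k] _).toRingHom ?_ ?_ ?_ ?_ _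
  · simp [Ev]
  · simp only [AlgHom.toRingHom_eq_coe, RingHom.coe_coe, Ev_X]; rw [if_neg (by omega), if_neg (by omega)]
  · simp only [AlgHom.toRingHom_eq_coe, RingHom.coe_coe, Ev_X]; rw [if_neg (by omega), if_neg (by omega)]; simp
  · intro f
    have : (Ev j : MvPolynomial ℕ k →ₐ[k] _).comp (sw i (i+1)) = (sw (i-1) i).comp (Ev j) := by
      apply MvPolynomial.algHom_ext; intro c
      simp only [AlgHom.comp_apply, sw_X, Ev_X, Equiv.swap_apply_def]
      split_ifs <;> first | omega | simp [sw_X, Equiv.swap_apply_def] <;> (try split_ifs) <;> first | omega | rfl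
    exact DFunLike.congr_fun this f

lemma Ev_T_eq (j : ℕ) (f : MvPolynomial ℕ k) :
    Ev j (TT q j (j+1) f) = C q * Ev (j+1) f := by
  have := congrArg (Ev j) (TT_spec q j (j+1) f)
  have hs : Ev j (sw j (j+1) f) = Ev (j+1) f := by
    have : (Ev j : MvPolynomial ℕ k →ₐ[k] _).comp (sw j (j+1)) = Ev (j+1) := by
      apply MvPolynomial.algHom_ext; intro c
      simp only [AlgHom.comp_apply, sw_X, Ev_X, Equiv.swap_apply_def]
      split_ifs <;> first | omega | rfl | simp_all
    exact DFunLike.congr_fun this f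
  have hC : ∀ c : k, Ev j (C c) = C c := by intro c; simp [Ev]
  have x1 : Ev j (X j : MvPolynomial ℕ k) = 0 := by rw [Ev_X]; simp
  have x2 : Ev j (X (j+1) : MvPolynomial ℕ k) = X j := by rw [Ev_X]; simp
  rw [map_mul, map_add, map_mul, map_mul, map_mul, map_sub, map_sub, map_mul, hs, x1, x2, hC, hC] at this
  apply mul_left_cancel₀ (X_ne_zero j : (X j : MvPolynomial ℕ k) ≠ 0)
  linear_combination -this

lemma Ev_T_pred (j : ℕ) (f : MvPolynomial ℕ k) :
    Ev (j+1) (TT q j (j+1) f) = Ev j f + C (q - 1) * Ev (j+1) f := by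
  have := congrArg (Ev (j+1)) (TT_spec q j (j+1) f)
  have hs : Ev (j+1) (sw j (j+1) f) = Ev j f := by
    have : (Ev (j+1) : MvPolynomial ℕ k →ₐ[k] _).comp (sw j (j+1)) = Ev j := by
      apply MvPolynomial.algHom_ext; intro c
      simp only [AlgHom.comp_apply, sw_X, Ev_X, Equiv.swap_apply_def]
      split_ifs <;> first | omega | rfl | simp_all
    exact DFunLike.congr_fun this f
  have hC : ∀ c : k, Ev (j+1) (C c) = C c := by intro c; simp [Ev]
  have x1 : Ev (j+1) (X j : MvPolynomial ℕ k) = X j := by rw [Ev_X, if_pos (by omega)]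
  have x2 : Ev (j+1) (X (j+1) : MvPolynomial ℕ k) = 0 := by rw [Ev_X]; simp
  rw [map_mul, map_add, map_mul, map_mul, map_mul, map_sub, map_sub, map_mul, hs, x1, x2, hC, hC] at this
  apply mul_left_cancel₀ (X_ne_zero j : (X j : MvPolynomial ℕ k) ≠ 0)
  linear_combination this

end
end QT


namespace QT
open MvPolynomial
set_option linter.unusedSectionVars false

/-- skipping index -/
def skp (j : ℕ) (γ : ℕ → ℕ) : ℕ → ℕ := fun a => if a < j then γ a else γ (a+1)

section
variable {k : Type*} [CommRing k] [IsDomain k] (q : k)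

lemma Ev_ym_zero {n j : ℕ} (hj : j < n) {γ : ℕ → ℕ} (h : 0 < γ j) :
    Ev j (ym n γ : MvPolynomial ℕ k) = 0 := by
  unfold ym
  rw [map_prod]
  apply prod_eq_zero (i := j) (by simpa using hj)
  rw [map_pow, Ev_X]; simp; omega

lemma Ev_ym {n j : ℕ} (hj : j ≤ n) {γ : ℕ → ℕ} (h : γ j = 0) :
    Ev j (ym (n+1) γ : MvPolynomial ℕ k) = ym n (skp j γ) := by
  unfold ym
  rw [map_prod, ← prod_erase (range (n+1)) (a := j) (by simp [h])]
  refine prod_bij' (fun a _ => if a < j then a else a - 1) (fun a _ => if a < j then a else a + 1)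
    ?_ ?_ ?_ ?_ ?_
  · intro a ha; simp only [mem_erase, mem_range] at *; split_ifs <;> omega
  · intro a ha; simp only [mem_erase, mem_range] at *; split_ifs <;> omega
  · intro a ha; simp only [mem_erase, mem_range] at *; split_ifs <;> omega
  · intro a ha; simp only [mem_range] at *; split_ifs <;> omega
  · intro a ha
    simp only [mem_erase, mem_range] at *
    rw [map_pow, Ev_X]
    by_cases h1 : a < j
    · simp [h1, skp]
    · have h2 : ¬ (a - 1 < j) := by omega
      have h3 : a - 1 + 1 = a := by omega
      simp [h1, h2, h3, skp, ha.1]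

lemma F_C (n : ℕ) (γ : ℕ → ℕ) : ∀ j < n, (∀ i, j ≤ i → i < n → 0 < γ i) →
    Ev j (F q n γ) = 0 := by
  induction γ using F_ind n with
  | h0 γ h => intro j hj hp; rw [F_srt q h, Ev_ym_zero hj (hp j le_rfl hj)]
  | h1 γ i hi hd IH =>
    intro j hj hp
    have IH' := IH _ (mu_lt hi hd)
    rw [F_T q n γ i hi hd]
    have hpi := hp i
    have hpi1 := hp (i+1)
    rcases lt_trichotomy i j with h | h | h
    · by_cases h' : i + 1 < j
      · rw [Ev_T_lt q h', IH' j hj, TT_zero q (by omega)]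
        intro a ha han
        rw [sq_ne (by omega) (by omega)]; exact hp a ha han
      · obtain rfl : j = i + 1 := by omega
        rw [Ev_T_pred, IH' i (by omega), IH' (i+1) hj]
        · simp
        · intro a ha han
          have := hp a
          rw [sq_apply]; split_ifs <;> omega
        · intro a ha han
          have := hp a
          rw [sq_apply]; split_ifs <;> omega
    · subst h
      rw [Ev_T_eq, IH' (i+1) (by omega)]
      · simp
      · intro a ha han
        have := hp a
        rw [sq_apply]; split_ifs <;> omega
    · rw [Ev_T_gt q h, IH' j hj, TT_zero q (by omega)]
      intro a ha han
      have := hp a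
      rw [sq_apply]; split_ifs <;> omega

lemma F_D (n : ℕ) (γ : ℕ → ℕ) : ∀ j ≤ n, γ j = 0 → (∀ i, j < i → i < n+1 → 0 < γ i) →
    Ev j (F q (n+1) γ) = F q n (skp j γ) := by
  induction γ using F_ind (n+1) with
  | h0 γ h =>
    intro j hj h0 hp
    rw [F_srt q h, Ev_ym hj h0, F_srt q]
    intro i hi
    simp only [skp]
    have := h.le (i := i) (j := i+1) (by omega) (by omega)
    have := h.le (i := i+1) (j := i+1+1) (by omega) (by omega)
    split_ifs <;> omega
  | h1 γ i hi hd IH =>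
    intro j hj h0 hp
    have IH' := IH _ (mu_lt hi hd)
    rw [F_T q (n+1) γ i hi hd]
    rcases lt_trichotomy i j with h | h | h
    · by_cases h' : i + 1 < j
      · rw [Ev_T_lt q h', IH' j hj]
        · rw [F_T q n (skp j γ) i (by omega)]
          · congr 2
            funext a; simp only [skp, sq_apply]; split_ifs <;> first | rfl | omega
          · simp only [skp]; split_ifs; exact hd
        · rw [sq_ne (by omega) (by omega)]; exact h0
        intro a ha han
        rw [sq_ne (by omega) (by omega)]; exact hp a ha han
      · obtain rfl : j = i + 1 := by omega
        have hsq : ∀ a, i < a → a < n + 1 → 0 < sq i γ a := by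
          intro a ha han
          have := hp a
          rw [sq_apply]; split_ifs <;> omega
        rw [Ev_T_pred, IH' i (by omega) (by rw [sq_left]; exact h0) hsq,
          F_C q (n+1) _ (i+1) (by omega) (fun a ha han => hsq a (by omega) han)]
        rw [mul_zero, add_zero]
        congr 1
        funext a; simp only [skp, sq_apply]
        split_ifs <;> first | rfl | omega | (congr 1; omega)
    · subst h; omega
    · rw [Ev_T_gt q h, IH' j hj]
      · obtain ⟨i, rfl⟩ : ∃ r, i = r + 1 := ⟨i - 1, by omega⟩
        rw [F_T q n (skp j γ) i (by omega)]
        · simp only [Nat.add_sub_cancel]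
          congr 2
          funext a; simp only [skp, sq_apply]; split_ifs <;> first | rfl | omega
        · simp only [skp]; rw [if_neg (by omega), if_neg (by omega)]; exact hd
      · rw [sq_ne (by omega) (by omega)]; exact h0
      · intro a ha han
        have := hp a
        have := hp i
        have := hp (i+1)
        rw [sq_apply]; split_ifs <;> omega

lemma sw_wh {i j : ℕ} {w : ℕ → ℕ} (hw : w i = w j) {d : ℕ} {f : MvPolynomial ℕ k}
    (hf : IsWeightedHomogeneous w f d) : IsWeightedHomogeneous w (sw i j f) d := by
  rw [f.as_sum, map_sum]
  apply IsWeightedHomogeneous.sum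
  intro c hc
  rw [sw, rename_monomial]
  apply isWeightedHomogeneous_monomial
  rw [← hf (mem_support_iff.1 hc)]
  rw [Finsupp.weight_apply, Finsupp.weight_apply, Finsupp.sum_mapDomain_index (by simp)
    (by intros; simp [add_mul])]
  apply Finsupp.sum_congr
  intro a _
  have : w (Equiv.swap i j a) = w a := by
    rw [Equiv.swap_apply_def]; split_ifs <;> simp_all
  rw [this]

lemma wh_div {w : ℕ → ℕ} {e d : ℕ} {D p : MvPolynomial ℕ k} (hD : D ≠ 0)
    (h1 : IsWeightedHomogeneous w D e) (h2 : IsWeightedHomogeneous w (D * p) (e + d)) :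
    IsWeightedHomogeneous w p d := by
  letI := weightedGradedAlgebra k w
  have key : ∀ d', weightedHomogeneousComponent w (e + d') (D * p)
      = D * weightedHomogeneousComponent w d' p := by
    intro d'
    have := DirectSum.coe_decompose_mul_add_of_left_mem (weightedHomogeneousSubmodule k w)
      (i := e) (j := d') (a := D) (b := p) h1
    have e1 := weightedDecomposition.decompose'_apply k w (D * p) (e + d')
    have e2 := weightedDecomposition.decompose'_apply k w p d'
    rw [← e1, ← e2]
    exact this
  intro c hc
  by_contra hne
  have h3 := key (Finsupp.weight w c)
  rw [h2.weightedHomogeneousComponent_ne _ (by omega)] at h3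
  have h4 := (mul_eq_zero.1 h3.symm).resolve_left hD
  apply hc
  have := congrArg (coeff c) h4
  rw [coeff_weightedHomogeneousComponent] at this
  simpa using this

lemma TT_wh {i j : ℕ} (hij : i ≠ j) {w : ℕ → ℕ} (hw : w i = w j) {d : ℕ} {f : MvPolynomial ℕ k}
    (hf : IsWeightedHomogeneous w f d) : IsWeightedHomogeneous w (TT q i j f) d := by
  have hX := isWeightedHomogeneous_X k w i
  have hY := isWeightedHomogeneous_X k w j
  rw [← hw] at hY
  apply wh_div (X_sub_ne hij) (hX.sub hY)
  rw [TT_spec]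
  exact ((hX.sub (hY.C_mul q)).mul (sw_wh hw hf)).add ((hX.mul hf).C_mul _)

lemma ym_wh (n : ℕ) (w β : ℕ → ℕ) :
    IsWeightedHomogeneous w (ym n β : MvPolynomial ℕ k) (∑ i ∈ range n, β i * w i) := by
  unfold ym
  apply IsWeightedHomogeneous.prod
  intro i _
  simpa using (isWeightedHomogeneous_X k w i).pow (β i)

lemma F_wh (n : ℕ) (w : ℕ → ℕ) (hw : ∀ i, i + 1 < n → w i = w (i+1)) (β : ℕ → ℕ) :
    IsWeightedHomogeneous w (F q n β) (∑ i ∈ range n, β i * w i) := by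
  induction β using F_ind n with
  | h0 β h => rw [F_srt q h]; exact ym_wh n w β
  | h1 β i hi hd IH =>
    rw [F_T q n β i hi hd]
    have := TT_wh q (i := i) (j := i+1) (by omega) (hw i hi) (IH _ (mu_lt hi hd))
    convert this using 1
    rw [← sum_swap hi]
    apply sum_congr rfl
    intro a _
    have : w (Equiv.swap i (i+1) a) = w a := by
      have := hw i hi
      rw [Equiv.swap_apply_def]; split_ifs <;> simp_all
    rw [this]; rfl

lemma F_supp (n : ℕ) (β : ℕ → ℕ) (c : ℕ →₀ ℕ) (hc : coeff c (F q n β) ≠ 0) :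
    (∀ i, n ≤ i → c i = 0) ∧ ∑ i ∈ range n, c i = ∑ i ∈ range n, β i := by
  have h1 : ∀ i, n ≤ i → c i = 0 := by
    have := F_wh q n (fun i => if n ≤ i then 1 else 0) (by
      intro i hi; rw [if_neg (by omega), if_neg (by omega)]) β hc
    have e : ∑ i ∈ range n, β i * (if n ≤ i then 1 else 0) = 0 := by
      apply sum_eq_zero; intro i hi; rw [mem_range] at hi; rw [if_neg (by omega)]; simp
    rw [e, Finsupp.weight_apply, Finsupp.sum, sum_eq_zero_iff] at this
    intro i hi
    by_contra hne
    have := this i (by simpa using hne)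
    simp [hi] at this; omega
  refine ⟨h1, ?_⟩
  have := F_wh q n (fun _ => 1) (by simp) β hc
  rw [Finsupp.weight_apply] at this
  simp at this
  rw [← this, Finsupp.sum]
  symm
  apply sum_subset
  · intro i hi; by_contra hn; simp at hn hi; exact hi (h1 i hn)
  · intro i _ hi; simpa using hi

lemma F_map {k' : Type*} [CommRing k'] [IsDomain k'] (ψ : k →+* k') (n : ℕ) (β : ℕ → ℕ) :
    map ψ (F q n β) = F (ψ q) n β := by
  induction β using F_ind n with
  | h0 β h => rw [F_srt q h, F_srt _ h]; simp [ym, map_prod]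
  | h1 β i hi hd IH =>
    rw [F_T q n β i hi hd, F_T (ψ q) n β i hi hd, ← IH _ (mu_lt hi hd)]
    apply TT_hom q (ψ q) (by omega)
    · simp
    · simp
    · simp
    · intro f; simp only [sw]; exact map_rename _ _ _

lemma F_one (n : ℕ) (β : ℕ → ℕ) : F (1 : k) n β = ym n β := by
  induction β using F_ind n with
  | h0 β h => rw [F_srt _ h]
  | h1 β i hi hd IH =>
    rw [F_T _ n β i hi hd, IH _ (mu_lt hi hd)]
    apply TT_unique _ (by omega)
    rw [sw_ym n i hi, sq_sq]; simp

end
end QT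


namespace QT
open MvPolynomial
set_option linter.unusedSectionVars false

/-- Laurent polynomials in countably many variables -/
abbrev LL (k : Type*) [CommRing k] := AddMonoidAlgebra k (ℕ →₀ ℤ)

section
variable {k : Type*} [CommRing k] [IsDomain k]

/-- monomial -/
noncomputable def mon (γ : ℕ →₀ ℤ) : LL k := AddMonoidAlgebra.single γ 1

lemma mon_zero : (mon 0 : LL k) = 1 := rfl
lemma mon_add (γ δ : ℕ →₀ ℤ) : (mon (γ + δ) : LL k) = mon γ * mon δ := by
  unfold mon; rw [AddMonoidAlgebra.single_mul_single, one_mul]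

lemma lin_ext {N : Type*} [AddCommMonoid N] [Module k N] {f g : LL k →ₗ[k] N}
    (h : ∀ γ, f (mon γ) = g (mon γ)) : f = g := by
  apply AddMonoidAlgebra.lhom_ext'
  intro γ
  apply LinearMap.ext_ring
  exact h γ

/-- variable -/
noncomputable def xx (i : ℕ) : LL k := mon (Finsupp.single i 1)
/-- inverse variable -/
noncomputable def yy (i : ℕ) : LL k := mon (Finsupp.single i (-1))

lemma xx_yy (i : ℕ) : (xx i * yy i : LL k) = 1 := by
  unfold xx yy; rw [← mon_add, ← mon_zero]; congr 1; ext; simp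
lemma yy_xx (i : ℕ) : (yy i * xx i : LL k) = 1 := by rw [mul_comm, xx_yy]

/-- polynomials in x -/
noncomputable def Xh : MvPolynomial ℕ k →ₐ[k] LL k := aeval xx
/-- polynomials in y -/
noncomputable def Yh : MvPolynomial ℕ k →ₐ[k] LL k := aeval yy

@[simp] lemma Xh_X (i) : Xh (X i : MvPolynomial ℕ k) = xx i := by simp [Xh]
@[simp] lemma Yh_X (i) : Yh (X i : MvPolynomial ℕ k) = yy i := by simp [Yh]
@[simp] lemma Xh_C (c : k) : Xh (C c : MvPolynomial ℕ k) = algebraMap k _ c := by simp [Xh]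
@[simp] lemma Yh_C (c : k) : Yh (C c : MvPolynomial ℕ k) = algebraMap k _ c := by simp [Yh]

/-- swap on Laurent -/
noncomputable def swL (i j : ℕ) : LL k →ₐ[k] LL k :=
  AddMonoidAlgebra.mapDomainAlgHom k k (Finsupp.mapDomain.addMonoidHom (Equiv.swap i j))

lemma swL_mon (i j γ) : swL i j (mon γ : LL k) = mon (Finsupp.mapDomain (Equiv.swap i j) γ) := by
  simp [swL, mon]

lemma swL_xx (i j l) : swL i j (xx l : LL k) = xx (Equiv.swap i j l) := by
  simp [xx, swL_mon]
lemma swL_yy (i j l) : swL i j (yy l : LL k) = yy (Equiv.swap i j l) := by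
  rw [yy, swL_mon, Finsupp.mapDomain_single]; rfl

lemma swL_Xh (i j) (f : MvPolynomial ℕ k) : swL i j (Xh f) = Xh (sw i j f) := by
  have : (swL i j).comp (Xh (k := k)) = Xh.comp (sw i j) := by
    apply MvPolynomial.algHom_ext; intro l; simp [swL_xx, sw_X]
  exact DFunLike.congr_fun this f
lemma swL_Yh (i j) (f : MvPolynomial ℕ k) : swL i j (Yh f) = Yh (sw i j f) := by
  have : (swL i j).comp (Yh (k := k)) = Yh.comp (sw i j) := by
    apply MvPolynomial.algHom_ext; intro l; simp [swL_yy, sw_X]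
  exact DFunLike.congr_fun this f
lemma swL_swL (i j) (f : LL k) : swL i j (swL i j f) = f := by
  have : (swL i j).toLinearMap ∘ₗ (swL i j).toLinearMap = (LinearMap.id : LL k →ₗ[k] LL k) := by
    apply lin_ext; intro γ; simp [swL_mon, ← Finsupp.mapDomain_comp, ← Equiv.coe_trans]
  exact DFunLike.congr_fun this f

/-- integer-indexed coefficient -/
noncomputable def cz (Θ : PowerSeries (LL k)) (e : ℤ) : LL k :=
  if 0 ≤ e then PowerSeries.coeff e.toNat Θ else 0

/-- residue map -/
noncomputable def rh (n : ℕ) (Θ : PowerSeries (LL k)) : LL k →ₗ[k] LL k :=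
  (Finsupp.linearCombination k (fun γ : ℕ →₀ ℤ => (mon (γ.erase n) * cz Θ (γ n) : LL k))) ∘ₗ
    (AddMonoidAlgebra.coeffLinearEquiv k).toLinearMap

lemma rh_mon (n Θ γ) : rh n Θ (mon γ : LL k) = mon (γ.erase n) * cz Θ (γ n) := by
  simp [rh, mon, AddMonoidAlgebra.coeffLinearEquiv]

lemma rh_add (n) (Θ Θ' : PowerSeries (LL k)) : rh n (Θ + Θ') = rh n Θ + rh n Θ' := by
  apply lin_ext; intro γ
  simp only [rh_mon, LinearMap.add_apply, cz]; split_ifs <;> simp [mul_add]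

lemma rh_C (n) (Θ : PowerSeries (LL k)) (c h : LL k) :
    rh n (PowerSeries.C c * Θ) h = c * rh n Θ h := by
  have : rh n (PowerSeries.C c * Θ) = (LinearMap.mulLeft k c) ∘ₗ rh n Θ := by
    apply lin_ext; intro γ
    simp only [rh_mon, LinearMap.comp_apply, LinearMap.mulLeft_apply, cz]
    split_ifs
    · rw [PowerSeries.coeff_C_mul]; ring
    · simp
  rw [this]; rfl

lemma rh_X (n) (Θ : PowerSeries (LL k)) (h : LL k) :
    rh n (PowerSeries.X * Θ) h = rh n Θ (yy n * h) := by
  have : rh n (PowerSeries.X * Θ) = rh n Θ ∘ₗ (LinearMap.mulLeft k (yy n)) := by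
    apply lin_ext; intro γ
    simp only [LinearMap.comp_apply, LinearMap.mulLeft_apply, yy, ← mon_add, rh_mon, cz]
    have e1 : (Finsupp.single n (-1) + γ).erase n = γ.erase n := by
      ext a; by_cases h : a = n <;> simp [h, Finsupp.erase_ne, Ne.symm]
    have e2 : (Finsupp.single n (-1) + γ : ℕ →₀ ℤ) n = γ n - 1 := by simp; ring
    rw [e1, e2]
    congr 1
    by_cases h1 : 0 ≤ γ n - 1
    · obtain ⟨a, ha⟩ : ∃ a : ℕ, γ n = a + 1 := ⟨(γ n - 1).toNat, by omega⟩
      rw [if_pos h1, if_pos (by omega), ha]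
      have : ((a:ℤ)+1).toNat = a + 1 := by omega
      rw [this, mul_comm, PowerSeries.coeff_succ_mul_X]; simp
    · rw [if_neg h1]
      by_cases h2 : 0 ≤ γ n
      · have : γ n = 0 := by omega
        simp [this]
      · rw [if_neg h2]
  rw [this]; rfl

/-- coefficients -/
def Lin (n : ℕ) : Subalgebra k (LL k) where
  carrier := {A | ∀ Θ B, rh n Θ (A * B) = A * rh n Θ B}
  mul_mem' := by
    intro a b ha hb Θ B
    rw [mul_assoc, ha, hb, mul_assoc]
  add_mem' := by
    intro a b ha hb Θ B
    rw [add_mul, map_add, ha, hb, add_mul]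
  algebraMap_mem' := by
    intro r Θ B
    rw [← Algebra.smul_def, ← Algebra.smul_def, map_smul]

lemma Lin_mul {n : ℕ} {A : LL k} (hA : A ∈ Lin n) (Θ B) : rh n Θ (A * B) = A * rh n Θ B := hA Θ B

lemma Lin_mon {n : ℕ} {γ : ℕ →₀ ℤ} (h : γ n = 0) : (mon γ : LL k) ∈ Lin n := by
  intro Θ B
  have : rh n Θ ∘ₗ (LinearMap.mulLeft k (mon γ)) = (LinearMap.mulLeft k (mon γ)) ∘ₗ rh n Θ := by
    apply lin_ext; intro δ
    simp only [LinearMap.comp_apply, LinearMap.mulLeft_apply, ← mon_add, rh_mon]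
    have e1 : (γ + δ).erase n = γ + δ.erase n := by
      ext a; by_cases h' : a = n
      · subst h'; simp [h]
      · simp [Finsupp.erase_ne h']
    rw [e1, mon_add, mul_assoc]; simp [h]
  exact DFunLike.congr_fun this B

lemma Lin_xx {n i : ℕ} (h : i ≠ n) : (xx i : LL k) ∈ Lin n := Lin_mon (by simp [h])
lemma Lin_yy {n i : ℕ} (h : i ≠ n) : (yy i : LL k) ∈ Lin n := Lin_mon (by simp [h])

lemma rh_lin {n : ℕ} {c : LL k} (hc : c ∈ Lin n) (Θ h) :
    rh n Θ ((1 - c * yy n) * h) = rh n ((1 - PowerSeries.C c * PowerSeries.X) * Θ) h := by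
  have : (1 - PowerSeries.C c * PowerSeries.X) * Θ =
    Θ + PowerSeries.C (-c) * (PowerSeries.X * Θ) := by rw [map_neg]; ring
  rw [this, rh_add, LinearMap.add_apply, rh_C, rh_X, sub_mul, one_mul, map_sub, mul_assoc,
    Lin_mul hc]
  ring

/-- power series with coefficients in a subalgebra -/
def SC (A : Subalgebra k (LL k)) : Subring (PowerSeries (LL k)) where
  carrier := {f | ∀ n, PowerSeries.coeff n f ∈ A}
  mul_mem' := by
    intro a b ha hb n
    rw [PowerSeries.coeff_mul]
    exact sum_mem (fun p _ => mul_mem (ha _) (hb _))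
  one_mem' := by
    intro n; rw [PowerSeries.coeff_one]; split_ifs
    · exact one_mem _
    · exact zero_mem _
  add_mem' := by
    intro a b ha hb n
    rw [map_add]; exact add_mem (ha n) (hb n)
  zero_mem' := by intro n; rw [map_zero]; exact zero_mem _
  neg_mem' := by intro a ha n; rw [map_neg]; exact neg_mem (ha n)

lemma SC_C {A : Subalgebra k (LL k)} {c} (h : c ∈ A) : PowerSeries.C c ∈ SC A := by
  intro n; rw [PowerSeries.coeff_C]; split_ifs
  · exact h
  · exact zero_mem _
lemma SC_X {A : Subalgebra k (LL k)} : PowerSeries.X ∈ SC A := by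
  intro n; rw [PowerSeries.coeff_X]; split_ifs
  · exact one_mem _
  · exact zero_mem _

/-- linear factor -/
noncomputable def lf (a : LL k) : PowerSeries (LL k) := 1 - PowerSeries.C a * PowerSeries.X
/-- geometric series -/
noncomputable def geo (a : LL k) : PowerSeries (LL k) := PowerSeries.mk (fun n => a ^ n)

lemma lf_geo (a : LL k) : lf a * geo a = 1 := by
  unfold lf
  ext n
  rw [sub_mul, one_mul, map_sub, mul_assoc, PowerSeries.coeff_C_mul]
  cases n with
  | zero => simp [geo]
  | succ n => rw [mul_comm PowerSeries.X, PowerSeries.coeff_succ_mul_X]; simp [geo, pow_succ']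
lemma SC_lf {A : Subalgebra k (LL k)} {a} (h : a ∈ A) : lf a ∈ SC A :=
  sub_mem (one_mem _) (mul_mem (SC_C h) SC_X)
lemma SC_geo {A : Subalgebra k (LL k)} {a} (h : a ∈ A) : geo a ∈ SC A := by
  intro n; simp only [geo, PowerSeries.coeff_mk]; exact pow_mem h n

lemma map_lf (φ : LL k →+* LL k) (a : LL k) : PowerSeries.map φ (lf a) = lf (φ a) := by
  simp [lf]
lemma map_geo (φ : LL k →+* LL k) (a : LL k) : PowerSeries.map φ (geo a) = geo (φ a) := by
  ext n; simp [geo]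

lemma cz_mem {A : Subalgebra k (LL k)} {Θ} (h : Θ ∈ SC A) (e : ℤ) : cz Θ e ∈ A := by
  unfold cz; split_ifs
  · exact h _
  · exact zero_mem _

lemma rh_swL {n i j : ℕ} (hi : n ≠ i) (hj : n ≠ j) {Θ : PowerSeries (LL k)}
    (hΘ : PowerSeries.map (swL i j).toRingHom Θ = Θ) (h : LL k) :
    rh n Θ (swL i j h) = swL i j (rh n Θ h) := by
  have : rh n Θ ∘ₗ (swL i j).toLinearMap = (swL i j).toLinearMap ∘ₗ rh n Θ := by
    apply lin_ext; intro γ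
    simp only [LinearMap.comp_apply, AlgHom.toLinearMap_apply, swL_mon, rh_mon, map_mul]
    have e0 : ∀ a, Finsupp.mapDomain (Equiv.swap i j) γ a = γ (Equiv.swap i j a) := by
      intro a
      have := Finsupp.mapDomain_apply (Equiv.swap i j).injective γ (Equiv.swap i j a)
      simpa using this
    have e0' : ∀ a, Finsupp.mapDomain (Equiv.swap i j) (γ.erase n) a
        = γ.erase n (Equiv.swap i j a) := by
      intro a
      have := Finsupp.mapDomain_apply (Equiv.swap i j).injective (γ.erase n) (Equiv.swap i j a)
      simpa using this
    have e1 : (Finsupp.mapDomain (Equiv.swap i j) γ).erase n =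
        Finsupp.mapDomain (Equiv.swap i j) (γ.erase n) := by
      ext a
      rw [e0']
      by_cases h' : a = n
      · subst h'
        rw [Equiv.swap_apply_of_ne_of_ne hi hj]; simp
      · rw [Finsupp.erase_ne h', e0, Finsupp.erase_ne]
        intro h2; apply h'
        rw [← Equiv.swap_apply_of_ne_of_ne hi hj] at h2
        exact (Equiv.swap i j).injective h2
    rw [e1, e0, Equiv.swap_apply_of_ne_of_ne hi hj]
    congr 1
    unfold cz
    split_ifs
    · conv_lhs => rw [← hΘ]
      rw [PowerSeries.coeff_map]; rfl
    · simp
  exact DFunLike.congr_fun this h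

lemma rh_rh_swL {i j : ℕ} (hij : i ≠ j) {Θ : PowerSeries (LL k)}
    (hΘ : Θ ∈ SC (Lin i)) (h : LL k) :
    rh i Θ (rh j Θ (swL i j h)) = rh i Θ (rh j Θ h) := by
  have : rh i Θ ∘ₗ rh j Θ ∘ₗ (swL i j).toLinearMap = rh i Θ ∘ₗ rh j Θ := by
    apply lin_ext; intro γ
    simp only [LinearMap.comp_apply, AlgHom.toLinearMap_apply, swL_mon, rh_mon]
    have e0 : ∀ a, Finsupp.mapDomain (Equiv.swap i j) γ a = γ (Equiv.swap i j a) := by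
      intro a
      have := Finsupp.mapDomain_apply (Equiv.swap i j).injective γ (Equiv.swap i j a)
      simpa using this
    rw [mul_comm, Lin_mul (cz_mem hΘ _), mul_comm (mon (γ.erase j)), Lin_mul (cz_mem hΘ _)]
    simp only [rh_mon, e0, Finsupp.erase_ne hij, Equiv.swap_apply_left, Equiv.swap_apply_right]
    have e1 : ((Finsupp.mapDomain (Equiv.swap i j) γ).erase j).erase i = (γ.erase j).erase i := by
      ext a
      by_cases h1 : a = i
      · simp [h1]
      by_cases h2 : a = j
      · subst h2; simp [Finsupp.erase_ne h1]
      simp [Finsupp.erase_ne h1, Finsupp.erase_ne h2, e0, Equiv.swap_apply_of_ne_of_ne h1 h2]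
    rw [e1]; ring
  exact DFunLike.congr_fun this h
end
end QT


namespace QT
open MvPolynomial
set_option linter.unusedSectionVars false

section
variable {k : Type*} [CommRing k] [IsDomain k]

/-- iterated residue -/
noncomputable def eps (Θ : ℕ → PowerSeries (LL k)) : ℕ → (LL k →ₗ[k] k)
  | 0 => Finsupp.lapply 0 ∘ₗ (AddMonoidAlgebra.coeffLinearEquiv k).toLinearMap
  | n + 1 => eps Θ n ∘ₗ rh n (Θ n)

lemma eps_succ (Θ : ℕ → PowerSeries (LL k)) (n h) : eps Θ (n+1) h = eps Θ n (rh n (Θ n) h) := rfl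

lemma eps_zero_one (Θ : ℕ → PowerSeries (LL k)) : eps Θ 0 1 = 1 := by
  rw [← mon_zero]; simp [eps, mon, AddMonoidAlgebra.coeffLinearEquiv]

/-- the constant q -/
noncomputable def qc (q : k) : LL k := algebraMap k (LL k) q

/-- theta series -/
noncomputable def th (q : k) (n : ℕ) : PowerSeries (LL k) :=
  ∏ i ∈ range n, (lf (xx i) * geo (qc q * xx i))

lemma qc_mem (A : Subalgebra k (LL k)) (q : k) : qc q ∈ A := A.algebraMap_mem q

lemma th_SC (q : k) {n j : ℕ} (h : n ≤ j) : th q n ∈ SC (Lin j) := by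
  refine prod_mem fun i hi => ?_
  rw [mem_range] at hi
  have := Lin_xx (k := k) (n := j) (i := i) (by omega)
  exact mul_mem (SC_lf this) (SC_geo (mul_mem (qc_mem _ _) this))

lemma th_sw (q : k) {n i : ℕ} (h : i + 1 < n) :
    PowerSeries.map (swL i (i+1)).toRingHom (th q n) = th q n := by
  unfold th
  rw [map_prod]
  refine prod_bij' (fun a _ => Equiv.swap i (i+1) a) (fun a _ => Equiv.swap i (i+1) a) ?_ ?_ ?_ ?_ ?_
  · intro a ha; simp only [mem_range, Equiv.swap_apply_def] at *; split_ifs <;> omega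
  · intro a ha; simp only [mem_range, Equiv.swap_apply_def] at *; split_ifs <;> omega
  · intro a ha; simp
  · intro a ha; simp
  · intro a ha
    have e1 : (swL i (i+1)).toRingHom (xx a : LL k) = xx (Equiv.swap i (i+1) a) := swL_xx _ _ _
    have e2 : (swL i (i+1)).toRingHom (qc q : LL k) = qc q := AlgHom.commutes _ _
    rw [map_mul, map_lf, map_geo, map_mul, e1, e2]

lemma core (q : k) (i : ℕ) : ∀ n, i + 2 ≤ n → ∀ g h : LL k,
    (1 - xx i * yy (i+1)) * g = h - swL i (i+1) h →
    eps (th q) n ((1 - qc q * (xx i * yy (i+1))) * g) = 0 := by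
  intro n hn
  induction n, hn using Nat.le_induction with
  | base =>
    intro g h e
    rw [show i + 2 = (i + 1) + 1 from rfl, eps_succ, eps_succ, ← mul_assoc]
    have l1 : (xx i : LL k) ∈ Lin (i+1) := Lin_xx (by omega)
    rw [rh_lin (mul_mem (qc_mem _ _) l1)]
    have e2 : (1 - PowerSeries.C (qc q * xx i) * PowerSeries.X) * th q (i+1) =
        (1 - PowerSeries.C (xx i) * PowerSeries.X) * th q i := by
      have := lf_geo (qc q * (xx i : LL k))
      change lf _ * _ = lf _ * _
      rw [th, prod_range_succ, ← th]
      linear_combination (th q i * lf (xx i)) * this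
    rw [e2, ← rh_lin l1, e, map_sub, map_sub, rh_rh_swL (by omega) (th_SC q le_rfl), sub_self,
      map_zero]
  | succ n hn ih =>
    intro g h e
    have l1 : (xx i * yy (i+1) : LL k) ∈ Lin n := mul_mem (Lin_xx (by omega)) (Lin_yy (by omega))
    rw [eps_succ, Lin_mul (sub_mem (one_mem _) (mul_mem (qc_mem _ _) l1))]
    apply ih _ (rh n (th q n) h)
    rw [← Lin_mul (sub_mem (one_mem _) l1), e, map_sub, rh_swL (by omega) (by omega)
      (th_sw q (by omega))]

lemma one_sub_r_ne (i : ℕ) : (1 - xx i * yy (i+1) : LL k) ≠ 0 := by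
  unfold xx yy
  rw [← mon_add, ← mon_zero, sub_ne_zero]
  intro h
  unfold mon at h
  have h2 := congrArg (fun f : LL k => f.coeff 0) h
  simp only [AddMonoidAlgebra.coeff_single] at h2
  rw [Finsupp.single_eq_same, Finsupp.single_eq_of_ne] at h2
  · exact one_ne_zero h2
  · intro h3
    have := DFunLike.congr_fun h3 i
    simp at this

lemma sw_symm (i j : ℕ) : (sw i j : MvPolynomial ℕ k →ₐ[k] _) = sw j i := by
  unfold sw; rw [Equiv.swap_comm]

lemma adjoint (q : k) {i n : ℕ} (hi : i + 1 < n) (P f : MvPolynomial ℕ k) :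
    eps (th q) n (Xh P * Yh (TT q i (i+1) f)) = eps (th q) n (Xh (TT q (i+1) i P) * Yh f) := by
  have a1 := congrArg Yh (TT_spec q i (i+1) f)
  have a2 := congrArg Xh (TT_spec q (i+1) i P)
  rw [sw_symm (i+1) i] at a2
  simp only [map_mul, map_add, map_sub, Xh_X, Yh_X, Xh_C, Yh_C, map_one] at a1 a2
  change _ = (_ - qc q * _) * _ + (qc q - 1) * _ at a1
  change _ = (_ - qc q * _) * _ + (qc q - 1) * _ at a2
  obtain ⟨f', hf⟩ := dvd_sub_sw i (i+1) f
  obtain ⟨P', hP⟩ := dvd_sub_sw i (i+1) P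
  have b1 := congrArg Yh hf
  have b2 := congrArg Xh hP
  simp only [map_mul, map_sub, Xh_X, Yh_X] at b1 b2
  have u1 := xx_yy (k := k) i
  have u2 := xx_yy (k := k) (i+1)
  rw [← sub_eq_zero, ← map_sub]
  set g : LL k := - (yy i * Yh f') * Xh P - xx (i+1) * Xh P' * Yh f with hg
  have w : (1 - xx i * yy (i+1)) * g = Xh P * Yh (sw i (i+1) f) -
      swL i (i+1) (Xh P * Yh (sw i (i+1) f)) := by
    rw [map_mul, swL_Xh, swL_Yh, sw_sw, hg]
    linear_combination Xh P * b1 - Yh f * b2 + (yy (i+1) * Yh f' * Xh P) * u1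
       + (xx i * Xh P' * Yh f) * u2
  have e : Xh P * Yh (TT q i (i+1) f) - Xh (TT q (i+1) i P) * Yh f =
      (1 - qc q * (xx i * yy (i+1))) * g := by
    apply mul_left_cancel₀ (one_sub_r_ne i)
    rw [mul_left_comm _ _ g, w, map_mul, swL_Xh, swL_Yh, sw_sw]
    set A := Yh (TT q i (i+1) f)
    set B := Xh (TT q (i+1) i P)
    set sf := Yh (sw i (i+1) f)
    set sP := Xh (sw i (i+1) P)
    have c1 : (1 - xx i * yy (i+1)) * A = (1 - qc q * (xx i * yy (i+1))) * sf + (qc q - 1) * Yh f := by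
      linear_combination xx i * a1 + (sf - A + (qc q - 1) * Yh f) * u1
    have c2 : (1 - xx i * yy (i+1)) * B = (1 - qc q * (xx i * yy (i+1))) * sP + (qc q - 1) * Xh P := by
      linear_combination yy (i+1) * a2 + (sP - B + (qc q - 1) * Xh P) * u2
    linear_combination Xh P * c1 - Yh f * c2
  rw [e]
  exact core q i n (by omega) g _ w

/-- positive in x0 -/
noncomputable def K0 : Submodule k (LL k) := Submodule.span k {h | ∃ γ : ℕ →₀ ℤ, 0 < γ 0 ∧ h = mon γ}
/-- multiplier -/
noncomputable def N0 : Subalgebra k (LL k) where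
  carrier := {A | ∀ h ∈ K0, A * h ∈ K0}
  mul_mem' := by
    intro a b ha hb h hh
    rw [mul_assoc]; exact ha _ (hb _ hh)
  add_mem' := by
    intro a b ha hb h hh
    rw [add_mul]; exact add_mem (ha _ hh) (hb _ hh)
  algebraMap_mem' := by
    intro r h hh
    rw [← Algebra.smul_def]; exact K0.smul_mem _ hh

lemma N0_mon {γ : ℕ →₀ ℤ} (h : 0 ≤ γ 0) : (mon γ : LL k) ∈ N0 := by
  intro x hx
  refine Submodule.span_induction (p := fun x _ => mon γ * x ∈ K0) ?_ ?_ ?_ ?_ hx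
  · rintro x ⟨δ, hδ, rfl⟩
    rw [← mon_add]
    exact Submodule.subset_span ⟨_, by simp; omega, rfl⟩
  · simp
  · intro x y _ _ hx hy; rw [mul_add]; exact add_mem hx hy
  · intro a x _ hx; rw [mul_smul_comm]; exact K0.smul_mem _ hx

lemma N0_xx (i : ℕ) : (xx i : LL k) ∈ N0 := N0_mon (by
  by_cases h : i = 0 <;> simp [Finsupp.single_apply, h])
lemma N0_yy {i : ℕ} (h : i ≠ 0) : (yy i : LL k) ∈ N0 := N0_mon (by simp [h])
lemma K0_xx : (xx 0 : LL k) ∈ K0 := Submodule.subset_span ⟨_, by simp, rfl⟩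
lemma N0_Xh (P : MvPolynomial ℕ k) : Xh P ∈ N0 := by
  induction P using MvPolynomial.induction_on with
  | C a => rw [Xh_C]; exact N0.algebraMap_mem a
  | add p r hp hr => rw [map_add]; exact add_mem hp hr
  | mul_X p i hp => rw [map_mul, Xh_X]; exact mul_mem hp (N0_xx i)

lemma rh_K0 {n : ℕ} (hn : n ≠ 0) {Θ : PowerSeries (LL k)} (hΘ : Θ ∈ SC N0) {h : LL k}
    (hh : h ∈ K0) : rh n Θ h ∈ K0 := by
  refine Submodule.span_induction (p := fun x _ => rh n Θ x ∈ K0) ?_ ?_ ?_ ?_ hh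
  · rintro x ⟨δ, hδ, rfl⟩
    rw [rh_mon, mul_comm]
    apply cz_mem hΘ
    exact Submodule.subset_span ⟨_, by rw [Finsupp.erase_ne hn.symm]; exact hδ, rfl⟩
  · simp
  · intro x y _ _ hx hy; rw [map_add]; exact add_mem hx hy
  · intro a x _ hx; rw [map_smul]; exact K0.smul_mem _ hx

lemma th_N0 (q : k) (n : ℕ) : th q n ∈ SC N0 := by
  refine prod_mem fun i hi => ?_
  exact mul_mem (SC_lf (N0_xx i)) (SC_geo (mul_mem (qc_mem _ _) (N0_xx i)))

lemma eps_K0 (q : k) : ∀ n, 1 ≤ n → ∀ h ∈ K0, eps (th q) n h = 0 := by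
  intro n hn
  induction n, hn using Nat.le_induction with
  | base =>
    intro h hh
    rw [show 1 = 0 + 1 from rfl, eps_succ]
    have : rh 0 (th q 0) h = 0 := by
      refine Submodule.span_induction (p := fun x _ => rh 0 (th q 0) x = 0) ?_ ?_ ?_ ?_ hh
      · rintro x ⟨δ, hδ, rfl⟩
        rw [rh_mon]
        have : (th q 0 : PowerSeries (LL k)) = 1 := by simp [th]
        rw [this, cz, if_pos hδ.le, PowerSeries.coeff_one, if_neg (by omega), mul_zero]
      · simp
      · intro x y _ _ hx hy; rw [map_add, hx, hy, add_zero]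
      · intro a x _ hx; rw [map_smul, hx, smul_zero]
    rw [this, map_zero]
  | succ n hn ih =>
    intro h hh
    exact ih _ (rh_K0 (by omega) (th_N0 q n) hh)

lemma negativity (q : k) (n M : ℕ) (β : ℕ → ℕ) : ∀ (P : MvPolynomial ℕ k) (i : ℕ), i < n →
    β i < M → eps (th q) n (Xh (ym n (fun _ => M) * P) * Yh (F q n β)) = 0 := by
  induction β using F_ind n with
  | h0 β h =>
    intro P i hi hβ
    rw [F_srt q h]
    apply eps_K0 q n (by omega)
    have h0 : β 0 < M := (h.le (Nat.zero_le i) hi).trans_lt hβ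
    obtain ⟨n, rfl⟩ : ∃ n', n = n' + 1 := ⟨n - 1, by omega⟩
    obtain ⟨d, hd⟩ : ∃ d, M = β 0 + 1 + d := ⟨M - β 0 - 1, by omega⟩
    unfold ym
    rw [prod_range_succ', prod_range_succ']
    simp only [map_mul, map_prod, map_pow, Xh_X, Yh_X]
    have u : (xx 0 ^ M * yy 0 ^ β 0 : LL k) = xx 0 ^ d * xx 0 := by
      rw [hd, pow_add, pow_add, pow_one]
      have : (xx 0 : LL k) ^ β 0 * yy 0 ^ β 0 = 1 := by rw [← mul_pow, xx_yy, one_pow]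
      linear_combination (xx 0 * xx 0 ^ d) * this
    have e : ((∏ a ∈ range n, (xx (a+1) : LL k) ^ M) * xx 0 ^ M) * Xh P *
       ((∏ a ∈ range n, yy (a+1) ^ β (a+1)) * yy 0 ^ β 0) =
       (((∏ a ∈ range n, xx (a+1) ^ M) * Xh P * (∏ a ∈ range n, yy (a+1) ^ β (a+1))) * xx 0 ^ d)
        * xx 0 := by
      linear_combination ((∏ a ∈ range n, xx (a+1) ^ M) * Xh P *
        (∏ a ∈ range n, yy (a+1) ^ β (a+1))) * u
    rw [e]
    have m : (((∏ a ∈ range n, xx (a+1) ^ M) * Xh P * (∏ a ∈ range n, yy (a+1) ^ β (a+1)))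
        * xx 0 ^ d : LL k) ∈ N0 := by
      refine mul_mem (mul_mem (mul_mem ?_ (N0_Xh P)) ?_) (pow_mem (N0_xx 0) d)
      · exact prod_mem fun a _ => pow_mem (N0_xx _) _
      · exact prod_mem fun a _ => pow_mem (N0_yy (by omega)) _
    exact m _ K0_xx
  | h1 β j hj hd IH =>
    intro P i hi hβ
    rw [F_T q n β j hj hd, adjoint q hj, TT_mul_sym q (by omega)]
    · have hs : sq j β (Equiv.swap j (j+1) i) < M := by
        simp only [sq, Function.comp_apply, Equiv.swap_apply_self]; exact hβ
      refine IH _ (mu_lt hj hd) _ _ ?_ hs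
      simp only [Equiv.swap_apply_def]; split_ifs <;> omega
    · rw [sw_symm, sw_ym n j hj]; rfl

/-- dual kernel -/
noncomputable def Kap (q : k) (j : ℕ) : PowerSeries (LL k) :=
  geo (xx j) * ∏ i ∈ range j, (lf (qc q * xx i) * geo (xx i))
/-- its coefficients -/
noncomputable def kk (q : k) (j e : ℕ) : LL k := PowerSeries.coeff e (Kap q j)
/-- products -/
noncomputable def kap (q : k) (n : ℕ) (c : ℕ →₀ ℕ) : LL k := ∏ j ∈ range n, kk q j (c j)

lemma W_SC (q : k) {n j : ℕ} (h : n ≤ j) :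
    (∏ i ∈ range n, (lf (qc q * xx i) * geo (xx i)) : PowerSeries (LL k)) ∈ SC (Lin j) := by
  refine prod_mem fun i hi => ?_
  rw [mem_range] at hi
  have := Lin_xx (k := k) (n := j) (i := i) (by omega)
  exact mul_mem (SC_lf (mul_mem (qc_mem _ _) this)) (SC_geo this)

lemma kk_Lin (q : k) {j n : ℕ} (h : j < n) (e : ℕ) : kk q j e ∈ Lin n :=
  (mul_mem (SC_geo (Lin_xx (by omega))) (W_SC q h.le) : Kap q j ∈ SC (Lin n)) e

lemma Xh_range_xx (i : ℕ) : (xx i : LL k) ∈ (Xh (k := k)).range := ⟨X i, Xh_X i⟩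

lemma kk_Xh (q : k) (j e : ℕ) : kk q j e ∈ (Xh (k := k)).range := by
  refine (mul_mem (SC_geo (Xh_range_xx j)) (prod_mem fun i hi => ?_) :
    Kap q j ∈ SC (Xh (k := k)).range) e
  exact mul_mem (SC_lf (mul_mem (qc_mem _ _) (Xh_range_xx i))) (SC_geo (Xh_range_xx i))

lemma kap_Lin (q : k) {j n : ℕ} (h : j ≤ n) (c) : kap q j c ∈ Lin n :=
  prod_mem fun i hi => kk_Lin q (by rw [mem_range] at hi; omega) _
lemma kap_Xh (q : k) (n c) : ∃ P, kap q n c = Xh (k := k) P := by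
  have : kap q n c ∈ (Xh (k := k)).range := prod_mem fun i _ => kk_Xh q _ _
  obtain ⟨P, hP⟩ := this
  exact ⟨P, hP.symm⟩

lemma kk_zero (q : k) (j : ℕ) : kk q j 0 = 1 := by
  simp [kk, Kap, geo, lf, PowerSeries.coeff_zero_eq_constantCoeff, map_prod]

lemma rh_pow (n d : ℕ) (Θ : PowerSeries (LL k)) (h : LL k) :
    rh n Θ (yy n ^ d * h) = rh n (PowerSeries.X ^ d * Θ) h := by
  induction d generalizing h with
  | zero => simp
  | succ d ih =>
    rw [pow_succ, mul_assoc, ih, ← rh_X, ← mul_assoc, ← pow_succ']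

lemma rh_geo (n e : ℕ) (Ψ W : PowerSeries (LL k)) (hW : W ∈ SC (Lin n)) :
    rh n Ψ (PowerSeries.coeff e (geo (xx n) * W)) = PowerSeries.coeff e (Ψ * W) := by
  rw [PowerSeries.coeff_mul, PowerSeries.coeff_mul, map_sum]
  apply sum_congr rfl
  rintro ⟨a, b⟩ _
  simp only [geo, PowerSeries.coeff_mk]
  rw [mul_comm, Lin_mul (hW b), mul_comm]
  congr 1
  have : (xx n ^ a : LL k) = mon (Finsupp.single n (a:ℤ)) := by
    clear * -
    induction a with
    | zero => simp [mon_zero]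
    | succ a ih => rw [pow_succ, ih, xx, ← mon_add, ← Finsupp.single_add]; simp
  rw [this, rh_mon]
  have : (Finsupp.single n (a:ℤ)).erase n = 0 := by simp
  rw [this, mon_zero, one_mul]
  simp [cz]

lemma rh_kk (q : k) (n e d : ℕ) :
    rh n (th q n) (yy n ^ d * kk q n e) = if e = d then 1 else 0 := by
  rw [rh_pow, kk, Kap, rh_geo _ _ _ _ (W_SC q le_rfl), mul_assoc]
  have : th q n * ∏ i ∈ range n, (lf (qc q * xx i) * geo (xx i)) = 1 := by
    rw [th, ← prod_mul_distrib]
    apply prod_eq_one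
    intro i _
    have h1 := lf_geo (xx i : LL k)
    have h2 := lf_geo (qc q * xx i : LL k)
    linear_combination lf (xx i) * geo (xx i) * h2 + h1
  rw [this, mul_one, PowerSeries.coeff_X_pow]

lemma repr_ym (q : k) (n : ℕ) (c d : ℕ →₀ ℕ) :
    eps (th q) n (kap q n c * Yh (ym n d)) = if ∀ i < n, c i = d i then 1 else 0 := by
  induction n with
  | zero => simp [kap, ym, eps_zero_one]
  | succ n ih =>
    have e : kap q (n+1) c * Yh (ym (n+1) d) =
        (kap q n c * Yh (ym n d)) * (yy n ^ d n * kk q n (c n)) := by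
      unfold kap ym
      rw [prod_range_succ, prod_range_succ, map_mul, map_pow, Yh_X]; ring
    have m : kap q n c * Yh (ym n d) ∈ Lin n := by
      refine mul_mem (kap_Lin q le_rfl c) ?_
      unfold ym; rw [map_prod]
      refine prod_mem fun i hi => ?_
      rw [map_pow, Yh_X]
      rw [mem_range] at hi
      exact pow_mem (Lin_yy (by omega)) _
    rw [e, eps_succ, Lin_mul m, rh_kk]
    by_cases h : c n = d n
    · rw [if_pos h, mul_one, ih]
      congr 1
      apply propext
      refine ⟨fun h1 i hi => ?_, fun h1 i hi => h1 i (by omega)⟩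
      by_cases h2 : i = n
      · rw [h2, h]
      · exact h1 i (by omega)
    · rw [if_neg h, mul_zero, map_zero, if_neg]
      intro h1; exact h (h1 n (by omega))

lemma monomial_ym (n : ℕ) (d : ℕ →₀ ℕ) (h : ∀ i, n ≤ i → d i = 0) (a : k) :
    monomial d a = C a * ym n d := by
  rw [monomial_eq]
  congr 1
  unfold ym
  apply Finsupp.prod_of_support_subset
  · intro i hi
    rw [mem_range]
    by_contra h1
    exact (Finsupp.mem_support_iff.1 hi) (h i (by omega))
  · intro i _; simp

lemma repr_coeff (q : k) (n : ℕ) (c : ℕ →₀ ℕ) (hc : ∀ i, n ≤ i → c i = 0)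
    (f : MvPolynomial ℕ k) (hf : ∀ d, coeff d f ≠ 0 → ∀ i, n ≤ i → d i = 0) :
    eps (th q) n (kap q n c * Yh f) = coeff c f := by
  conv_lhs => rw [f.as_sum, map_sum, mul_sum, map_sum]
  have : ∀ d ∈ f.support, eps (th q) n (kap q n c * Yh (monomial d (coeff d f))) =
      if d = c then coeff c f else 0 := by
    intro d hd
    have hd0 := hf d (mem_support_iff.1 hd)
    rw [monomial_ym n d hd0, map_mul Yh, Yh_C, mul_left_comm, ← Algebra.smul_def, map_smul, repr_ym]
    by_cases h : d = c
    · subst h; simp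
    · rw [if_neg h, if_neg, smul_zero]
      intro h1; apply h; ext i
      by_cases hi : i < n
      · exact (h1 i hi).symm
      · rw [hd0 i (by omega), hc i (by omega)]
  rw [sum_congr rfl this, sum_ite_eq']
  split_ifs with h
  · rfl
  · exact (notMem_support_iff.1 h).symm

lemma Ev_coeff (n : ℕ) (c : ℕ →₀ ℕ) (hc : ∀ i, n ≤ i → c i = 0)
    (f : MvPolynomial ℕ k) (hf : ∀ d, coeff d f ≠ 0 → ∀ i, n + 1 ≤ i → d i = 0) :
    coeff c (Ev n f) = coeff c f := by
  conv_lhs => rw [f.as_sum, map_sum, coeff_sum]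
  have : ∀ d ∈ f.support, coeff c (Ev n (monomial d (coeff d f))) =
      if d = c then coeff c f else 0 := by
    intro d hd
    have hd0 := hf d (mem_support_iff.1 hd)
    by_cases h : d n = 0
    · have h2 : ∀ i, n ≤ i → d i = 0 := by
        intro i hi
        rcases eq_or_lt_of_le hi with rfl | h3
        · exact h
        · exact hd0 i h3
      have : Ev n (monomial d (coeff d f)) = monomial d (coeff d f) := by
        rw [monomial_ym n d h2, map_mul]
        congr 1
        · exact AlgHom.commutes _ _
        · unfold ym; rw [map_prod]
          apply prod_congr rfl
          intro i hi
          rw [mem_range] at hi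
          rw [map_pow, Ev_X, if_pos hi]
      rw [this, coeff_monomial]
      split_ifs with h3
      · rw [h3]
      · rfl
    · have : Ev n (monomial d (coeff d f)) = 0 := by
        rw [monomial_ym (n+1) d hd0, map_mul]
        unfold ym
        rw [prod_range_succ, map_mul, map_pow, Ev_X]
        simp [h]
      rw [this, if_neg]
      · simp
      · rintro rfl; exact h (hc n le_rfl)
  rw [sum_congr rfl this, sum_ite_eq']
  split_ifs with h
  · rfl
  · exact (notMem_support_iff.1 h).symm
end
end QT


namespace QT
open MvPolynomial
set_option linter.unusedSectionVars false

/-- lowering exponent -/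
def wl (n : ℕ) (S : Finset ℕ) (β : ℕ → ℕ) : ℕ :=
  ps n (fun a l => if β a = β l + 1 ∧ a ∈ S ∧ l ∉ S then 1 else 0)

/-- overlap statistic -/
def ds (n : ℕ) (α β : ℕ → ℕ) : ℕ :=
  ps n (fun i l => min (β i) (β l + 1) - max (α i) (α l))

lemma ps_add (n : ℕ) (g g' : ℕ → ℕ → ℕ) : ps n g + ps n g' = ps n (fun a l => g a l + g' a l) := by
  unfold ps
  rw [← sum_add_distrib]
  refine sum_congr rfl fun a _ => ?_
  rw [← sum_add_distrib]
  refine sum_congr rfl fun l _ => ?_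
  split_ifs <;> simp

lemma ds_self (n : ℕ) (β : ℕ → ℕ) : ds n β β = 0 := by
  unfold ds
  have : ps n (fun i l => min (β i) (β l + 1) - max (β i) (β l)) = ps n (fun _ _ => 0) :=
    ps_congr fun a l _ _ => by omega
  rw [this]; simp [ps]

lemma wl_empty (n : ℕ) (β : ℕ → ℕ) : wl n ∅ β = 0 := by simp [wl, ps]

lemma toggle (n : ℕ) (γ β : ℕ → ℕ) (hle : ∀ i < n, γ i ≤ β i) (p : ℕ) (hp : p < n)
    (hpA : γ p < β p) (hmin : ∀ i < n, γ i < β i → γ p ≤ γ i)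
    (hfirst : ∀ i < p, γ i < β i → γ p < γ i)
    (S : Finset ℕ) (hS : ∀ i ∈ S, γ i < β i) (hpS : p ∉ S) :
    ds n (fun i => γ i + ind (insert p S) i) β + wl n (insert p S) (fun i => γ i + ind (insert p S) i)
    = ds n (fun i => γ i + ind S i) β + wl n S (fun i => γ i + ind S i) := by
  unfold ds wl
  rw [ps_add, ps_add]
  apply ps_congr
  intro a l hal hln
  have ha := hle a (by omega)
  have hl := hle l hln
  have ma := hmin a (by omega)
  have ml := hmin l hln
  have fa := hfirst a
  have sa := hS a
  have sl := hS l
  simp only [ind, mem_insert]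
  by_cases h1 : a = p
  · subst h1
    have h2 : l ≠ a := by omega
    by_cases h3 : l ∈ S
    · have := sl h3
      simp only [hpS, h2, h3, true_or, or_true, false_or, if_true, if_false, not_true, not_false_eq_true, and_true, true_and,
        and_false, false_and]
      omega
    · simp only [hpS, h2, h3, true_or, or_true, false_or, or_false, if_true, if_false, not_true, not_false_eq_true, and_true, true_and,
        and_false, false_and]
      split_ifs <;> omega
  · by_cases h2 : l = p
    · subst h2
      have fa := fa hal
      by_cases h3 : a ∈ S
      · have := sa h3
        simp only [hpS, h1, h3, true_or, or_true, false_or, or_false, if_true, if_false, not_true, not_false_eq_true, and_true, true_and,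
        and_false, false_and]
        split_ifs <;> omega
      · simp only [hpS, h1, h3, true_or, or_true, false_or, or_false, if_true, if_false, not_true, not_false_eq_true, and_true, true_and,
        and_false, false_and]
        omega
    · simp only [h1, h2, false_or]
      congr

section
variable {k : Type*} [CommRing k] [IsDomain k] (q : k)

lemma inversion (n : ℕ) (γ β : ℕ → ℕ) (hle : ∀ i < n, γ i ≤ β i) (hne : ∃ i < n, γ i < β i) :
    ∑ S ∈ ((range n).filter (fun i => γ i < β i)).powerset, (-1 : k) ^ #S *
      q ^ (ds n (fun i => γ i + ind S i) β + wl n S (fun i => γ i + ind S i)) = 0 := by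
  set A := (range n).filter (fun i => γ i < β i) with hA
  have hAne : A.Nonempty := by
    obtain ⟨i, hi, h⟩ := hne; exact ⟨i, by simp [hA, hi, h]⟩
  obtain ⟨p0, hp0, hmin0⟩ := exists_min_image A γ hAne
  have hB : (A.filter (fun i => γ i = γ p0)).Nonempty := ⟨p0, by simp [hp0]⟩
  obtain ⟨p, hp, hmin1⟩ := exists_min_image _ id hB
  rw [mem_filter] at hp
  obtain ⟨hpA, hpe⟩ := hp
  have hpA' := hpA
  rw [hA, mem_filter, mem_range] at hpA'
  rw [← insert_erase hpA, sum_powerset_insert (by simp), ← sum_add_distrib]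
  apply sum_eq_zero
  intro S hS
  rw [mem_powerset] at hS
  have hpS : p ∉ S := fun h => by simpa using hS h
  rw [card_insert_of_notMem hpS, toggle n γ β hle p hpA'.1 hpA'.2 _ _ S _ hpS]
  · ring
  · intro i hi h
    rw [hpe]; exact hmin0 i (by simp [hA, hi, h])
  · intro i hi h
    have hiA : i ∈ A := by rw [hA, mem_filter, mem_range]; exact ⟨by omega, h⟩
    have h1 := hmin0 i hiA
    by_contra h2
    have : γ i = γ p0 := by omega
    have := hmin1 i (by simp [hiA, this])
    simp only [id] at this; omega
  · intro i hi
    have := mem_of_mem_erase (hS hi)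
    rw [hA, mem_filter] at this; exact this.2

lemma e_low (ψ : ℕ → k) (n : ℕ) (β : ℕ → ℕ) (hβ : ∀ i < n, 1 ≤ β i) :
    (∑ S ∈ (range n).powerset, qc (ψ #S) * ∏ i ∈ S, xx i) * Yh (F q n β) =
    ∑ S ∈ (range n).powerset, qc (ψ #S * q ^ wl n S β) * Yh (F q n (fun i => β i - ind S i)) := by
  have h1 : F q n β = ym n (fun _ => 1) * F q n (fun i => β i - 1) := by
    rw [← F_shift]; apply F_congr; intro i hi; have := hβ i hi; show β i = β i - 1 + 1; omega
  have h2 : (∑ S ∈ (range n).powerset, qc (ψ #S) * ∏ i ∈ S, xx i) * Yh (ym n (fun _ => 1)) =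
      Yh (es (fun r => ψ (n - r)) n) := by
    unfold es
    rw [map_sum, sum_mul]
    refine sum_bij' (fun S _ => range n \ S) (fun S _ => range n \ S) ?_ ?_ ?_ ?_ ?_
    · intro S hS; simp
    · intro S hS; simp
    · intro S hS; simp [inter_eq_right.2 (mem_powerset.1 hS)]
    · intro S hS; simp [inter_eq_right.2 (mem_powerset.1 hS)]
    · intro S hS
      rw [mem_powerset] at hS
      have hc := card_le_card hS
      rw [card_range] at hc
      rw [card_sdiff_of_subset hS, card_range, map_mul, Yh_C, mul_assoc]
      change _ = qc (ψ (n - (n - #S))) * _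
      rw [Nat.sub_sub_self hc]
      congr 1
      unfold ym
      rw [← prod_sdiff hS, ← prod_sdiff hS, map_mul, map_mul]
      have e1 : ∏ i ∈ S, (X i : MvPolynomial ℕ k) ^ ind (range n \ S) i = 1 := by
        apply prod_eq_one; intro i hi; simp [ind, hi]
      have e2 : ∏ i ∈ range n \ S, (X i : MvPolynomial ℕ k) ^ ind (range n \ S) i =
          ∏ i ∈ range n \ S, X i ^ 1 := by
        apply prod_congr rfl; intro i hi; simp only [ind, hi, if_true]
      have e3 : (∏ i ∈ S, (xx i : LL k)) * Yh (∏ i ∈ S, X i ^ 1) = 1 := by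
        rw [map_prod, ← prod_mul_distrib]
        apply prod_eq_one; intro i _; simp [xx_yy]
      rw [e1, e2, map_one, mul_one, mul_left_comm, e3, mul_one]
  rw [h1, map_mul, ← mul_assoc, h2, ← map_mul, e_pieri, map_sum]
  refine sum_bij' (fun S _ => range n \ S) (fun S _ => range n \ S) ?_ ?_ ?_ ?_ ?_
  · intro S hS; simp
  · intro S hS; simp
  · intro S hS; simp [inter_eq_right.2 (mem_powerset.1 hS)]
  · intro S hS; simp [inter_eq_right.2 (mem_powerset.1 hS)]
  · intro S hS
    rw [mem_powerset] at hS
    rw [card_sdiff_of_subset hS, card_range, map_mul, Yh_C]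
    change qc _ * _ = _
    congr 1
    · congr 3
      unfold wt wl
      apply ps_congr
      intro a l hal hl
      have b1 := hβ a (by omega)
      have b2 := hβ l hl
      simp only [mem_sdiff, mem_range]
      have c1 : (β a - 1 = β l - 1 + 1) = (β a = β l + 1) := by apply propext; omega
      have c2 : a < n := by omega
      simp [c1, c2, hl]
    · congr 1
      apply F_congr
      intro i hi
      have := hβ i hi
      simp only [ind, mem_sdiff, mem_range, hi, true_and]
      split_ifs <;> simp_all

/-- complete homogeneous generating series -/
noncomputable def Hs (n : ℕ) : PowerSeries (LL k) := ∏ i ∈ range n, geo (xx i)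

lemma E_coeff (n j : ℕ) : PowerSeries.coeff j (∏ i ∈ range n, lf (xx i : LL k)) =
    ∑ S ∈ (range n).powerset, qc (if #S = j then (-1)^j else 0) * ∏ i ∈ S, xx i := by
  have : ∏ i ∈ range n, lf (xx i : LL k) = ∑ S ∈ (range n).powerset,
      PowerSeries.C ((-1)^#S * ∏ i ∈ S, xx i) * PowerSeries.X ^ #S := by
    unfold lf
    simp only [sub_eq_add_neg]
    rw [prod_one_add]
    refine sum_congr rfl fun S _ => ?_
    rw [prod_neg, prod_mul_distrib, prod_const, map_mul, map_pow, map_neg, map_one, map_prod]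
    ring
  rw [this, map_sum]
  refine sum_congr rfl fun S _ => ?_
  rw [PowerSeries.coeff_C_mul_X_pow]
  by_cases h : j = #S
  · subst h; rw [if_pos rfl, if_pos rfl, qc, map_pow, map_neg, map_one]
  · rw [if_neg h, if_neg (Ne.symm h)]; simp [qc]

lemma h_low (n : ℕ) : ∀ (N : ℕ) (β : ℕ → ℕ), (∀ i < n, N ≤ β i) →
    PowerSeries.coeff N (Hs n) * Yh (F q n β) = ∑ δ ∈ piAntidiag (range n) N,
      qc (q ^ ds n (fun i => β i - δ i) β) * Yh (F q n (fun i => β i - δ i)) := by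
  intro N
  induction N using Nat.strong_induction_on with
  | _ N IH =>
  intro β hβ
  rcases Nat.eq_zero_or_pos N with rfl | hN
  · rw [piAntidiag_zero, sum_singleton]
    have e0 : PowerSeries.coeff 0 (Hs n : PowerSeries (LL k)) = 1 := by
      simp [Hs, geo, PowerSeries.coeff_zero_eq_constantCoeff, map_prod]
    have e1 : (fun i => β i - (0 : ℕ → ℕ) i) = β := by funext i; simp
    rw [e0, e1, ds_self, pow_zero, qc, map_one]
  let V : (ℕ → ℕ) → Finset ℕ → LL k := fun δ S =>
    qc ((-1)^#S * q ^ (ds n (fun i => β i - δ i) β + wl n S (fun i => β i - δ i))) *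
      Yh (F q n (fun i => β i - δ i - ind S i))
  let U : ℕ × ℕ → LL k := fun p => ∑ δ ∈ piAntidiag (range n) p.2,
    ∑ S ∈ (range n).powerset.filter (fun S => #S = p.1), V δ S
  let T : ℕ × ℕ → LL k := fun p => PowerSeries.coeff p.1 (∏ i ∈ range n, lf (xx i : LL k)) *
    PowerSeries.coeff p.2 (Hs n) * Yh (F q n β)
  have hT : ∑ p ∈ antidiagonal N, T p = 0 := by
    simp only [T]
    rw [← sum_mul, ← PowerSeries.coeff_mul, Hs, ← prod_mul_distrib, prod_eq_one, PowerSeries.coeff_one,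
      if_neg (by omega), zero_mul]
    intro i _; exact lf_geo _
  have hU : ∑ p ∈ antidiagonal N, U p = 0 := by
    have : ∑ p ∈ antidiagonal N, U p = ∑ η ∈ piAntidiag (range n) N,
        ∑ S ∈ ((range n).filter (fun i => β i - η i < β i)).powerset,
          V (fun i => η i - ind S i) S := by
      simp only [U]
      simp only [sum_sigma']
      refine sum_bij' (fun x _ => ⟨fun i => x.2.1 i + ind x.2.2 i, x.2.2⟩)
        (fun y _ => ⟨(#y.2, N - #y.2), ⟨fun i => y.1 i - ind y.2 i, y.2⟩⟩) ?_ ?_ ?_ ?_ ?_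
      · rintro ⟨⟨j, l⟩, ⟨δ, S⟩⟩ h
        simp only [mem_sigma, HasAntidiagonal.mem_antidiagonal, mem_piAntidiag, mem_filter, mem_powerset] at h ⊢
        obtain ⟨h1, ⟨h2, h3⟩, h4, h5⟩ := h
        have e : ∑ i ∈ range n, ind S i = #S := by
          simp [ind, inter_eq_right.2 h4]
        refine ⟨⟨by rw [sum_add_distrib, e, h5, ← h1, ← h2, add_comm], ?_⟩, ?_⟩
        · intro i hi
          by_cases h6 : i ∈ S
          · exact h4 h6
          · exact h3 i (by simpa [ind, h6] using hi)
        · intro i hi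
          have := hβ i (by simpa using h4 hi)
          rw [mem_filter]; refine ⟨h4 hi, ?_⟩
          simp only [ind, hi, if_true]; omega
      · rintro ⟨η, S⟩ h
        simp only [mem_sigma, HasAntidiagonal.mem_antidiagonal, mem_piAntidiag, mem_filter, mem_powerset] at h ⊢
        obtain ⟨⟨h1, h2⟩, h3⟩ := h
        have h4 : S ⊆ range n := fun i hi => (mem_filter.1 (h3 hi)).1
        have h5 : ∀ i, ind S i ≤ η i := by
          intro i; unfold ind; split_ifs with h
          · have := (mem_filter.1 (h3 h)).2; omega
          · omega
        have e : ∑ i ∈ range n, ind S i = #S := by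
          simp [ind, inter_eq_right.2 h4]
        have e2 : ∑ i ∈ range n, (η i - ind S i) + #S = N := by
          rw [← e, ← sum_add_distrib, ← h1]
          refine sum_congr rfl fun i _ => ?_
          have := h5 i; omega
        refine ⟨by omega, ⟨by omega, ?_⟩, h4, trivial⟩
        intro i hi; exact h2 i (by omega)
      · rintro ⟨⟨j, l⟩, ⟨δ, S⟩⟩ h
        simp only [mem_sigma, HasAntidiagonal.mem_antidiagonal, mem_piAntidiag, mem_filter, mem_powerset] at h ⊢
        obtain ⟨h1, ⟨h2, h3⟩, h4, h5⟩ := h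
        subst h5
        have : N - #S = l := by omega
        simp only [this, Nat.add_sub_cancel]
      · rintro ⟨η, S⟩ h
        simp only [mem_sigma, HasAntidiagonal.mem_antidiagonal, mem_piAntidiag, mem_filter, mem_powerset] at h ⊢
        obtain ⟨⟨h1, h2⟩, h3⟩ := h
        have h5 : ∀ i, ind S i ≤ η i := by
          intro i; unfold ind; split_ifs with h
          · have := (mem_filter.1 (h3 h)).2; omega
          · omega
        have : (fun i => η i - ind S i + ind S i) = η := by
          funext i; have := h5 i; omega
        simp only [this]
      · rintro ⟨⟨j, l⟩, ⟨δ, S⟩⟩ h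
        simp only [Nat.add_sub_cancel]
    rw [this]
    apply sum_eq_zero
    intro η hη
    rw [mem_piAntidiag] at hη
    have hηle : ∀ i < n, η i ≤ β i := by
      intro i hi
      refine le_trans ?_ (hβ i hi)
      rw [← hη.1]
      exact single_le_sum (f := η) (fun _ _ => Nat.zero_le _) (by simpa using hi)
    have key := inversion q n (fun i => β i - η i) β (fun i _ => Nat.sub_le _ _) (by
      by_contra h
      push Not at h
      have : ∑ i ∈ range n, η i = 0 := by
        apply sum_eq_zero; intro i hi; rw [mem_range] at hi
        have := h i hi; have := hβ i hi; have := hηle i hi; omega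
      have h2 := hη.1; rw [this] at h2; omega)
    have : ∀ S ∈ ((range n).filter (fun i => β i - η i < β i)).powerset,
        V (fun i => η i - ind S i) S = qc ((-1 : k) ^ #S *
      q ^ (ds n (fun i => (β i - η i) + ind S i) β + wl n S (fun i => (β i - η i) + ind S i))) *
        Yh (F q n (fun i => β i - η i)) := by
      intro S hS
      rw [mem_powerset] at hS
      have h5 : ∀ i, ind S i ≤ η i := by
        intro i; unfold ind; split_ifs with h
        · have := (mem_filter.1 (hS h)).2; omega
        · omega
      have h6 : ∀ i, ind S i = 0 ∨ i < n := by
        intro i; unfold ind; split_ifs with h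
        · right; simpa using (mem_filter.1 (hS h)).1
        · left; rfl
      have e : (fun i => β i - (η i - ind S i)) = (fun i => (β i - η i) + ind S i) := by
        funext i
        have := h5 i
        rcases h6 i with h | h
        · omega
        · have := hηle i h; omega
      simp only [V]
      rw [e]
      congr 2
      apply F_congr
      intro i hi
      have := h5 i; have := hηle i hi; show _ - _ - _ = _ - _; omega
    rw [sum_congr rfl this, ← sum_mul]
    have z : ∀ s : Finset (Finset ℕ), ∀ f : Finset ℕ → k, ∑ S ∈ s, qc (f S) = qc (∑ S ∈ s, f S) := by
      intro s f; simp [qc]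
    rw [z, key]; simp [qc]
  have hTU : ∀ p ∈ antidiagonal N, p ≠ (0, N) → T p = U p := by
    rintro ⟨j, l⟩ hp hne
    rw [HasAntidiagonal.mem_antidiagonal] at hp
    simp only at hp
    have hl : l < N := by
      by_contra h; apply hne
      have h1 : j = 0 := by omega
      have h2 : l = N := by omega
      rw [h1, h2]
    simp only [T, U]
    rw [mul_assoc, IH l hl β (fun i hi => by have := hβ i hi; omega), mul_sum]
    refine sum_congr rfl fun δ hδ => ?_
    rw [mem_piAntidiag] at hδ
    have hδle : ∀ i < n, δ i ≤ l := by
      intro i hi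
      rw [← hδ.1]
      exact single_le_sum (f := δ) (fun _ _ => Nat.zero_le _) (by simpa using hi)
    rw [mul_left_comm, E_coeff, e_low q (fun r => if r = j then (-1)^j else 0) n _
      (fun i hi => by have := hβ i hi; have := hδle i hi; omega), mul_sum, sum_filter]
    refine sum_congr rfl fun S _ => ?_
    split_ifs with h
    · simp only [V, h]
      rw [← mul_assoc]
      congr 1
      simp only [qc, ← map_mul]
      congr 1
      rw [pow_add]; ring
    · simp [qc]
  have mem : (0, N) ∈ antidiagonal N := by simp
  have : T (0, N) = U (0, N) := by
    rw [← add_sum_erase _ _ mem] at hT hU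
    have : ∑ p ∈ (antidiagonal N).erase (0, N), T p = ∑ p ∈ (antidiagonal N).erase (0, N), U p :=
      sum_congr rfl fun p hp => hTU p (mem_of_mem_erase hp) (ne_of_mem_erase hp)
    rw [this] at hT
    linear_combination hT - hU
  simp only [T, U] at this
  have e0 : PowerSeries.coeff 0 (∏ i ∈ range n, lf (xx i : LL k)) = 1 := by
    simp [lf, PowerSeries.coeff_zero_eq_constantCoeff, map_prod]
  rw [e0, one_mul] at this
  rw [this]
  refine sum_congr rfl fun δ _ => ?_
  have : (range n).powerset.filter (fun S => #S = 0) = {∅} := by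
    ext S; simp only [mem_filter, mem_powerset, card_eq_zero, mem_singleton]
    constructor
    · exact fun h => h.2
    · rintro rfl; simp
  rw [this, sum_singleton]
  simp only [V]
  simp [wl_empty, ind]
end
end QT


namespace QT
open MvPolynomial
set_option linter.unusedSectionVars false

/-- index set -/
def Idx (r d : ℕ) : Finset (ℕ →₀ ℕ) := finsuppAntidiag (range r) d

lemma mem_Idx {r d : ℕ} {c : ℕ →₀ ℕ} :
    c ∈ Idx r d ↔ ∑ i ∈ range r, c i = d ∧ ∀ i, r ≤ i → c i = 0 := by
  unfold Idx
  rw [mem_finsuppAntidiag]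
  refine and_congr Iff.rfl ?_
  constructor
  · intro h i hi
    by_contra h2
    have := h (Finsupp.mem_support_iff.2 h2)
    simp at this; omega
  · intro h i hi
    rw [mem_range]
    by_contra h2
    exact (Finsupp.mem_support_iff.1 hi) (h i (by omega))

/-- prepend a zero -/
def cns (b : ℕ → ℕ) : ℕ → ℕ := fun i => if i = 0 then 0 else b (i-1)

lemma ds_congr {n : ℕ} {α α' β β' : ℕ → ℕ} (h : ∀ i < n, α i = α' i) (h' : ∀ i < n, β i = β' i) :
    ds n α β = ds n α' β' := by
  unfold ds; apply ps_congr; intro a l hal hl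
  rw [h a (by omega), h l hl, h' a (by omega), h' l hl]

lemma ds_shift (n M : ℕ) (α β : ℕ → ℕ) :
    ds n (fun i => α i + M) (fun i => β i + M) = ds n α β := by
  unfold ds; apply ps_congr; intro a l hal hl
  show min (β a + M) (β l + M + 1) - max (α a + M) (α l + M) = min (β a) (β l + 1) - max (α a) (α l)
  omega

section
variable {k : Type*} [CommRing k] [IsDomain k] (q : k)

/-- the test element -/
noncomputable def ph (m n : ℕ) : LL k :=
  Yh (ym n (fun _ => m)) * PowerSeries.coeff (m * n) (Hs n)

lemma Xh_Yh_ym (n M : ℕ) : (Xh (ym n (fun _ => M)) * Yh (ym n (fun _ => M)) : LL k) = 1 := by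
  unfold ym
  rw [map_prod, map_prod, ← prod_mul_distrib]
  apply prod_eq_one; intro i _
  rw [map_pow, map_pow, Xh_X, Yh_X, ← mul_pow, xx_yy, one_pow]

lemma coeff_top (r : ℕ) (c : ℕ →₀ ℕ) (hc : ∀ i, r ≤ i → c i = 0) (γ : ℕ → ℕ) :
    eps (th q) (r+1) (kap q (r+1) c * Yh (F q (r+1) γ)) =
      if γ r = 0 then coeff c (F q r γ) else 0 := by
  have hs : ∀ d, coeff d (F q (r+1) γ) ≠ 0 → ∀ i, r + 1 ≤ i → d i = 0 :=
    fun d hd => (F_supp q (r+1) γ d hd).1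
  rw [repr_coeff q (r+1) c (fun i hi => hc i (by omega)) _ hs, ← Ev_coeff r c hc _ hs]
  split_ifs with h
  · rw [F_D q r γ r le_rfl h (by intro i h1 h2; omega)]
    congr 1
    apply F_congr; intro i hi; simp [skp, hi]
  · rw [F_C q (r+1) γ r (by omega), coeff_zero]
    intro i h1 h2
    have : i = r := by omega
    subst this; omega

lemma main_col (r m d : ℕ) (b c : ℕ →₀ ℕ) (hb : b ∈ Idx r d) (hc : ∀ i, r ≤ i → c i = 0) :
    eps (th q) (r+1) (ph m (r+1) * kap q r c * Yh (F q (r+1) (cns b))) =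
    ∑ a ∈ Idx r d, if ∀ i < r + 1, a i ≤ cns b i + m then
      q ^ ds (r+1) a (fun i => cns b i + m) * coeff c (F q r a) else 0 := by
  have hk : kap q r c = kap q (r+1) c := by
    unfold kap; rw [prod_range_succ, hc r le_rfl, kk_zero, mul_one]
  rw [hk]
  obtain ⟨P, hP⟩ := kap_Xh q (r+1) c
  set n := r + 1 with hn
  set N := m * n with hN
  set B : ℕ → ℕ := fun i => cns b i + m with hB
  have e1 : ph m n * kap q n c * Yh (F q n (cns b)) = Xh (ym n (fun _ => N) * P) *
      (PowerSeries.coeff N (Hs n) * Yh (F q n (fun i => B i + N))) := by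
    rw [F_shift q n N B, hB, F_shift q n m (cns b), hP, ph]
    simp only [map_mul]
    have := Xh_Yh_ym (k := k) n N
    linear_combination (-(Yh (ym n (fun _ => m)) * PowerSeries.coeff N (Hs n) * Xh P * Yh (F q n (cns b)))) * this
  rw [e1, h_low q n N _ (fun i _ => by show N ≤ B i + N; omega), mul_sum, map_sum]
  have e2 : ∀ δ ∈ piAntidiag (range n) N,
      eps (th q) n (Xh (ym n (fun _ => N) * P) *
      (qc (q ^ ds n (fun i => B i + N - δ i) (fun i => B i + N)) *
        Yh (F q n (fun i => B i + N - δ i)))) =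
      if (∀ i < n, δ i ≤ B i) ∧ B r - δ r = 0 then
        q ^ ds n (fun i => B i - δ i) B * coeff c (F q r (fun i => B i - δ i)) else 0 := by
    intro δ hδ0
    rw [mul_left_comm]
    unfold qc
    rw [← Algebra.smul_def, map_smul, smul_eq_mul]
    by_cases h : ∀ i < n, δ i ≤ B i
    · have h1 : F q n (fun i => B i + N - δ i) = ym n (fun _ => N) * F q n (fun i => B i - δ i) := by
        rw [← F_shift]; apply F_congr; intro i hi
        have := h i hi; show _ = _ - _ + _; omega
      have h2 : ds n (fun i => B i + N - δ i) (fun i => B i + N) = ds n (fun i => B i - δ i) B := by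
        rw [← ds_shift n N (fun i => B i - δ i) B]
        apply ds_congr
        · intro i hi; have := h i hi; show _ = _ - _ + _; omega
        · intro i hi; rfl
      have h3 : Xh (ym n (fun _ => N) * P) * Yh (F q n (fun i => B i + N - δ i)) =
          kap q n c * Yh (F q n (fun i => B i - δ i)) := by
        rw [h1, hP]; simp only [map_mul]
        have := Xh_Yh_ym (k := k) n N
        linear_combination (Xh P * Yh (F q n (fun i => B i - δ i))) * this
      rw [h3, h2, hn, coeff_top q r c hc]
      by_cases h4 : B r - δ r = 0
      · rw [if_pos h4, if_pos ⟨h, h4⟩]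
      · rw [if_neg h4, if_neg (fun h5 => h4 h5.2), mul_zero]
    · rw [if_neg (fun h5 => h h5.1)]
      push Not at h
      obtain ⟨i, hi, hlt⟩ := h
      have hle : δ i ≤ N := by
        have := (mem_piAntidiag.1 hδ0).1
        rw [← this]
        exact single_le_sum (f := δ) (fun _ _ => Nat.zero_le _) (by simpa using hi)
      rw [negativity q n N _ P i hi (by show B i + N - δ i < N; omega), mul_zero]
  rw [sum_congr rfl e2, ← sum_filter, ← sum_filter]
  rw [mem_Idx] at hb
  have hBs : ∑ i ∈ range n, B i = d + N := by
    simp only [hB, sum_add_distrib, sum_const, card_range, smul_eq_mul]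
    rw [hn, sum_range_succ', ← hn]
    have : ∑ i ∈ range r, cns b (i+1) = d := by rw [← hb.1]; simp [cns]
    rw [this]; simp [cns, hN, mul_comm]
  refine sum_bij' (fun δ _ => Finsupp.onFinset (range r) (fun i => if i < r then B i - δ i else 0)
     (by intro i hi; rw [mem_range]; by_contra h; simp [h] at hi))
    (fun a _ => fun i => if i < n then B i - a i else 0) ?_ ?_ ?_ ?_ ?_
  · intro δ hδ
    simp only [mem_filter, mem_piAntidiag, mem_Idx, Finsupp.onFinset_apply] at hδ ⊢
    obtain ⟨⟨h1, h2⟩, h3, h4⟩ := hδ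
    refine ⟨⟨?_, ?_⟩, ?_⟩
    · have h5 : ∑ i ∈ range n, (B i - δ i) + N = d + N := by
        rw [← hBs]
        conv_lhs => rw [← h1]
        rw [← sum_add_distrib]
        refine sum_congr rfl fun i hi => ?_
        have := h3 i (by simpa using hi); omega
      rw [hn, sum_range_succ, h4] at h5
      have : ∑ i ∈ range r, (if i < r then B i - δ i else 0) = ∑ i ∈ range r, (B i - δ i) :=
        sum_congr rfl fun i hi => if_pos (by simpa using hi)
      rw [this]; omega
    · intro i hi; rw [if_neg (by omega)]
    · intro i hi
      show _ ≤ B i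
      split_ifs <;> omega
  · intro a ha
    simp only [mem_filter, mem_piAntidiag, mem_Idx] at ha ⊢
    obtain ⟨⟨h1, h2⟩, h3⟩ := ha
    refine ⟨⟨?_, ?_⟩, ?_, ?_⟩
    · have h5 : ∑ i ∈ range n, (if i < n then B i - a i else 0) + ∑ i ∈ range n, a i = d + N := by
        rw [← hBs, ← sum_add_distrib]
        refine sum_congr rfl fun i hi => ?_
        rw [mem_range] at hi
        have h9 : a i ≤ B i := h3 i hi
        rw [if_pos hi]; omega
      have h6 : ∑ i ∈ range n, a i = d := by rw [hn, sum_range_succ, h2 r le_rfl, h1, add_zero]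
      rw [h6] at h5
      have : ∀ f : ℕ → ℕ, (range n).sum f = ∑ i ∈ range n, f i := fun _ => rfl
      rw [this]; omega
    · intro i hi; rw [mem_range]; by_contra h; simp [h] at hi
    · intro i hi; split_ifs; omega
    · rw [if_pos (by omega), h2 r le_rfl]; omega
  · intro δ hδ
    simp only [mem_filter, mem_piAntidiag] at hδ
    obtain ⟨⟨h1, h2⟩, h3, h4⟩ := hδ
    funext i
    simp only [Finsupp.onFinset_apply]
    split_ifs with h5 h6
    · have := h3 i h5; omega
    · have : i = r := by omega
      subst this; have := h3 i h5; omega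
    · by_contra h6
      have := h2 i (Ne.symm h6)
      simp at this; omega
  · intro a ha
    simp only [mem_filter, mem_Idx] at ha
    obtain ⟨⟨h1, h2⟩, h3⟩ := ha
    ext i
    simp only [Finsupp.onFinset_apply]
    split_ifs with h5 h6
    · have h9 : a i ≤ B i := h3 i (by omega)
      omega
    · omega
    · exact (h2 i (by omega)).symm
  · intro δ hδ
    simp only [mem_filter, mem_piAntidiag] at hδ
    obtain ⟨⟨h1, h2⟩, h3, h4⟩ := hδ
    congr 1
    · congr 1
      apply ds_congr
      · intro i hi
        simp only [Finsupp.onFinset_apply]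
        split_ifs with h5
        · rfl
        · have : i = r := by omega
          subst this; exact h4
      · intro i hi; rfl
    · congr 1
      apply F_congr
      intro i hi
      simp only [Finsupp.onFinset_apply, if_pos hi]

/-- diagonal coefficient -/
noncomputable def aa (r m : ℕ) (c b : ℕ →₀ ℕ) : k :=
  eps (th q) (r+1) (ph m (r+1) * kap q r c * Yh (rename Nat.succ (ym r b)))

lemma trace_eq {k' : Type*} [CommRing k'] [IsDomain k'] (ψ : k →+* k') (hψ : ψ q = 1)
    (r m d : ℕ) :
    ∑ c ∈ Idx r d, aa q r m c c = ∑ c ∈ Idx r d, if ∀ i < r + 1, c i ≤ cns c i + m then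
      q ^ ds (r+1) c (fun i => cns c i + m) else 0 := by
  classical
  let I := {x // x ∈ Idx r d}
  let A : Matrix I I k := fun c b => aa q r m c.1 b.1
  let Φ : Matrix I I k := fun c b => coeff c.1 (F q r b.1)
  let A' : Matrix I I k := fun a b => if ∀ i < r + 1, a.1 i ≤ cns b.1 i + m then
      q ^ ds (r+1) a.1 (fun i => cns b.1 i + m) else 0
  have h1 : A * Φ = Φ * A' := by
    ext c b
    rw [Matrix.mul_apply, Matrix.mul_apply]
    have hc := (mem_Idx.1 c.2).2
    have e := main_col q r m d b.1 c.1 b.2 hc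
    have hF : F q r b.1 = ∑ x ∈ Idx r d, C (coeff x (F q r b.1)) * ym r x := by
      conv_lhs => rw [(F q r b.1).as_sum]
      rw [sum_subset (s₂ := Idx r d)]
      · refine sum_congr rfl fun x hx => ?_
        exact monomial_ym r x (mem_Idx.1 hx).2 _
      · intro x hx
        have := F_supp q r b.1 x (mem_support_iff.1 hx)
        rw [mem_Idx]
        refine ⟨?_, this.1⟩
        rw [this.2]; exact (mem_Idx.1 b.2).1
      · intro x _ hx
        rw [notMem_support_iff.1 hx]; simp
    have e2 : eps (th q) (r+1) (ph m (r+1) * kap q r c.1 * Yh (F q (r+1) (cns b.1))) =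
        ∑ x ∈ Idx r d, aa q r m c.1 x * coeff x (F q r b.1) := by
      unfold cns
      conv_lhs => rw [F_cons, hF, map_sum, map_sum, mul_sum, map_sum]
      refine sum_congr rfl fun x _ => ?_
      rw [map_mul (rename Nat.succ), map_mul Yh, rename_C, Yh_C, mul_left_comm, ← Algebra.smul_def, map_smul, smul_eq_mul, mul_comm]
      rfl
    rw [e2] at e
    rw [sum_coe_sort (Idx r d) (fun x => aa q r m c.1 x * coeff x (F q r b.1)), e,
      ← sum_coe_sort]
    refine sum_congr rfl fun x _ => ?_
    simp only [A', Φ]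
    split_ifs
    · ring
    · simp
  have h2 : Φ.det ≠ 0 := by
    intro h
    have h3 := RingHom.map_det ψ Φ
    have h4 : ψ.mapMatrix Φ = 1 := by
      ext c b
      rw [RingHom.mapMatrix_apply, Matrix.map_apply]
      simp only [Φ]
      rw [← coeff_map, F_map, hψ, F_one]
      have := monomial_ym (k := k') r b.1 (mem_Idx.1 b.2).2 1
      rw [C_1, one_mul] at this
      rw [← this, coeff_monomial, Matrix.one_apply]
      by_cases h : c = b
      · rw [if_pos h, if_pos (by rw [h])]
      · rw [if_neg h, if_neg (fun h5 => h (Subtype.ext h5.symm))]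
    rw [h, h4, Matrix.det_one, map_zero] at h3
    exact zero_ne_one h3
  have h3 : A.trace = A'.trace := by
    apply mul_left_cancel₀ h2
    have a1 : Φ.det * A.trace = (A * (Φ * Φ.adjugate)).trace := by
      rw [Matrix.mul_adjugate, Matrix.mul_smul, mul_one, Matrix.trace_smul, smul_eq_mul]
    have a2 : Φ.det * A'.trace = (A' * (Φ.adjugate * Φ)).trace := by
      rw [Matrix.adjugate_mul, Matrix.mul_smul, mul_one, Matrix.trace_smul, smul_eq_mul]
    rw [a1, a2, ← mul_assoc, h1, mul_assoc, Matrix.trace_mul_comm, mul_assoc]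
  have h4 : ∑ x : I, aa q r m x.1 x.1 = ∑ x : I, (if ∀ i < r + 1, x.1 i ≤ cns x.1 i + m then
      q ^ ds (r+1) x.1 (fun i => cns x.1 i + m) else 0) := h3
  rw [← sum_coe_sort, h4]
  exact sum_coe_sort (Idx r d) (fun c : ℕ →₀ ℕ => if ∀ i < r + 1, c i ≤ cns c i + m then
      q ^ ds (r+1) c (fun i => cns c i + m) else 0)
end
end QT


namespace QT
open MvPolynomial
set_option linter.unusedSectionVars false

section
variable {k : Type*} [CommRing k] [IsDomain k] (q t : k)

/-- two-parameter series -/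
noncomputable def TH : ℕ → PowerSeries (LL k)
  | 0 => 1
  | r + 1 => th q (r+1) * PowerSeries.rescale (qc t) (Kap q r)

lemma rescale_lf (a : LL k) : PowerSeries.rescale (qc t) (lf a) = lf (qc t * a) := by
  unfold lf
  rw [map_sub, map_one, map_mul, PowerSeries.rescale_X]
  have : PowerSeries.rescale (qc t) (PowerSeries.C a) = PowerSeries.C a := by
    ext n; rw [PowerSeries.coeff_rescale, PowerSeries.coeff_C]; split_ifs with h <;> simp [h]
  rw [this, map_mul]; ring

lemma rescale_geo (a : LL k) : PowerSeries.rescale (qc t) (geo a) = geo (qc t * a) := by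
  ext n; rw [PowerSeries.coeff_rescale]; simp [geo, mul_pow]

lemma TH_eq (r : ℕ) : TH q t (r+1) = (∏ i ∈ range (r+1), lf (xx i)) *
    ((∏ i ∈ range (r+1), geo (qc q * xx i)) * (∏ i ∈ range (r+1), geo (qc t * xx i))) *
    ∏ i ∈ range r, lf (qc q * qc t * xx i) := by
  show th q (r+1) * _ = _
  unfold th Kap
  rw [map_mul, map_prod, rescale_geo]
  simp only [map_mul, rescale_geo, rescale_lf, prod_mul_distrib]
  rw [prod_range_succ (fun i => geo (qc t * xx i))]
  have : ∀ i, (qc t * (qc q * xx i) : LL k) = qc q * qc t * xx i := fun i => by ring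
  simp only [this]
  ring

lemma TH_symm : TH q t = TH t q := by
  funext n
  cases n with
  | zero => rfl
  | succ r =>
    rw [TH_eq, TH_eq, mul_comm (qc q) (qc t), mul_comm (∏ i ∈ range (r+1), geo (qc q * xx i))]

/-- level sums -/
noncomputable def UU (r d : ℕ) (φ : LL k) : k :=
  ∑ c ∈ Idx r d, eps (th q) (r+1) (φ * kap q r c * Yh (rename Nat.succ (ym r c)))

/-- one step -/
noncomputable def fe (r e : ℕ) (φ : LL k) : LL k :=
  rh (r+1) (th q (r+1)) (kk q r e * (yy (r+1) ^ e * φ))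

lemma Yh_ren (r : ℕ) (c : ℕ → ℕ) :
    Yh (rename Nat.succ (ym r c)) = (∏ i ∈ range r, yy (i+1) ^ c i : LL k) := by
  unfold ym; simp [map_prod]

lemma UU_succ (r d : ℕ) (φ : LL k) :
    UU q (r+1) d φ = ∑ p ∈ antidiagonal d, UU q r p.2 (fe q r p.1 φ) := by
  unfold UU
  rw [sum_sigma']
  symm
  refine sum_bij' (fun x _ => x.2 + Finsupp.single r x.1.1)
    (fun c _ => ⟨(c r, d - c r), c.erase r⟩) ?_ ?_ ?_ ?_ ?_
  · rintro ⟨⟨e, d'⟩, c⟩ hx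
    simp only [mem_sigma, HasAntidiagonal.mem_antidiagonal, mem_Idx] at hx ⊢
    obtain ⟨h1, h2, h3⟩ := hx
    constructor
    · rw [sum_range_succ]
      have : ∑ i ∈ range r, (c + Finsupp.single r e) i = ∑ i ∈ range r, c i := by
        refine sum_congr rfl fun i hi => ?_
        rw [mem_range] at hi
        rw [Finsupp.add_apply, Finsupp.single_eq_of_ne (by omega), add_zero]
      rw [this, h2, Finsupp.add_apply, Finsupp.single_eq_same, h3 r le_rfl]; omega
    · intro i hi
      rw [Finsupp.add_apply, Finsupp.single_eq_of_ne (by omega), add_zero]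
      exact h3 i (by omega)
  · intro c hc
    simp only [mem_sigma, HasAntidiagonal.mem_antidiagonal, mem_Idx] at hc ⊢
    obtain ⟨h1, h2⟩ := hc
    rw [sum_range_succ] at h1
    refine ⟨by omega, ?_, ?_⟩
    · have : ∑ i ∈ range r, (c.erase r) i = ∑ i ∈ range r, c i := by
        refine sum_congr rfl fun i hi => ?_
        rw [mem_range] at hi
        rw [Finsupp.erase_ne (by omega)]
      rw [this]; omega
    · intro i hi
      by_cases h : i = r
      · rw [h, Finsupp.erase_same]
      · rw [Finsupp.erase_ne h]; exact h2 i (by omega)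
  · rintro ⟨⟨e, d'⟩, c⟩ hx
    simp only [mem_sigma, HasAntidiagonal.mem_antidiagonal, mem_Idx] at hx
    obtain ⟨h1, h2, h3⟩ := hx
    have e1 : (c + Finsupp.single r e) r = e := by
      rw [Finsupp.add_apply, Finsupp.single_eq_same, h3 r le_rfl, zero_add]
    have e2 : (c + Finsupp.single r e).erase r = c := by
      ext i
      by_cases h : i = r
      · rw [h, Finsupp.erase_same, h3 r le_rfl]
      · rw [Finsupp.erase_ne h, Finsupp.add_apply, Finsupp.single_eq_of_ne (by omega), add_zero]
    simp only [e1, e2]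
    have : d - e = d' := by omega
    rw [this]
  · intro c hc
    exact Finsupp.erase_add_single r c
  · rintro ⟨⟨e, d'⟩, c⟩ hx
    simp only [mem_sigma, HasAntidiagonal.mem_antidiagonal, mem_Idx] at hx
    obtain ⟨h1, h2, h3⟩ := hx
    have e1 : (c + Finsupp.single r e) r = e := by
      rw [Finsupp.add_apply, Finsupp.single_eq_same, h3 r le_rfl, zero_add]
    have e2 : ∀ i ∈ range r, (c + Finsupp.single r e) i = c i := by
      intro i hi
      rw [mem_range] at hi
      rw [Finsupp.add_apply, Finsupp.single_eq_of_ne (by omega), add_zero]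
    simp only
    rw [eps_succ _ (r+1), fe]
    have hY : (∏ i ∈ range r, yy (i+1) ^ c i : LL k) ∈ Lin (r+1) :=
      prod_mem fun i hi => pow_mem (Lin_yy (by rw [mem_range] at hi; omega)) _
    have e4 : (∏ i ∈ range r, yy (i+1) ^ (c + Finsupp.single r e) i : LL k) =
        ∏ i ∈ range r, yy (i+1) ^ c i := prod_congr rfl (fun i hi => by rw [e2 i hi])
    rw [Yh_ren, Yh_ren, prod_range_succ, e1, e4]
    have hk : kap q (r+1) (c + Finsupp.single r e) = kap q r c * kk q r e := by
      unfold kap; rw [prod_range_succ, e1, prod_congr rfl (fun i hi => by rw [e2 i hi])]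
    rw [hk]
    have e3 : φ * (kap q r c * kk q r e) * ((∏ i ∈ range r, yy (i+1) ^ c i) * yy (r+1) ^ e) =
      (kap q r c * ∏ i ∈ range r, yy (i+1) ^ c i) * (kk q r e * (yy (r+1) ^ e * φ)) := by ring
    rw [e3, Lin_mul (mul_mem (kap_Lin q (by omega) c) hY)]
    congr 1; ring

lemma rh_sum (n : ℕ) {ι : Type*} (s : Finset ι) (f : ι → PowerSeries (LL k)) (h : LL k) :
    rh n (∑ i ∈ s, f i) h = ∑ i ∈ s, rh n (f i) h := by
  classical
  induction s using Finset.induction_on with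
  | empty =>
    rw [sum_empty, sum_empty]
    have := rh_C n 0 0 h
    simpa using this
  | insert a s ha ih => rw [sum_insert ha, sum_insert ha, rh_add, LinearMap.add_apply, ih]

lemma Kap_split (r D : ℕ) : ∃ g, PowerSeries.rescale (qc t) (Kap q r) =
    ∑ e ∈ range D, PowerSeries.C (qc t ^ e * kk q r e) * PowerSeries.X ^ e +
      PowerSeries.C (qc t ^ D) * g := by
  refine ⟨PowerSeries.mk (fun j => if j < D then 0 else qc t ^ (j - D) * kk q r j), ?_⟩
  apply PowerSeries.ext; intro j
  rw [PowerSeries.coeff_rescale, map_add, map_sum, PowerSeries.coeff_C_mul, PowerSeries.coeff_mk]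
  simp only [PowerSeries.coeff_C_mul, PowerSeries.coeff_X_pow]
  change qc t ^ j * kk q r j = _
  simp only [mul_ite, mul_one, mul_zero]
  rw [sum_ite_eq]
  simp only [mem_range]
  split_ifs with h
  · simp
  · rw [← mul_assoc, ← pow_add]
    have : D + (j - D) = j := by omega
    rw [this, zero_add]

lemma rh_TH (r D : ℕ) (φ : LL k) : ∃ w, rh (r+1) (TH q t (r+1)) φ =
    ∑ e ∈ range D, t ^ e • fe q r e φ + t ^ D • w := by
  obtain ⟨g, hg⟩ := Kap_split q t r D
  refine ⟨rh (r+1) (th q (r+1) * g) φ, ?_⟩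
  show rh (r+1) (th q (r+1) * _) φ = _
  rw [hg, mul_add, rh_add, LinearMap.add_apply, mul_sum, rh_sum]
  have hq : ∀ e, qc t ^ e = algebraMap k (LL k) (t ^ e) := fun e => (map_pow _ _ _).symm
  congr 1
  · refine sum_congr rfl fun e _ => ?_
    have : th q (r+1) * (PowerSeries.C (qc t ^ e * kk q r e) * PowerSeries.X ^ e) =
      PowerSeries.C (qc t ^ e * kk q r e) * (PowerSeries.X ^ e * th q (r+1)) := by ring
    rw [this, rh_C, ← rh_pow, fe, Lin_mul (kk_Lin q (by omega) e), hq, mul_assoc, Algebra.smul_def]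
  · rw [mul_left_comm, rh_C, hq, Algebra.smul_def]

lemma unroll (r : ℕ) : ∀ (D : ℕ) (φ : LL k),
    t ^ D ∣ eps (TH q t) (r+1) φ - ∑ d ∈ range D, t ^ d * UU q r d φ := by
  induction r with
  | zero =>
    intro D φ
    have h0 : ∀ d, UU q 0 d φ = if d = 0 then eps (TH q t) 1 φ else 0 := by
      intro d
      unfold UU Idx
      rw [range_zero]
      split_ifs with h
      · subst h
        have e1 : TH q t 0 = th q 0 := by simp [TH, th]
        rw [finsuppAntidiag_empty_zero, sum_singleton, eps_succ, eps_succ, e1]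
        simp [kap, ym]
        rfl
      · rw [finsuppAntidiag_empty_of_ne_zero h, sum_empty]
    simp only [h0, mul_ite, mul_zero, sum_ite_eq', mem_range, pow_zero, one_mul]
    split_ifs with h
    · simp
    · have : D = 0 := by omega
      simp [this]
  | succ r ih =>
    intro D φ
    obtain ⟨w, hw⟩ := rh_TH q t r D φ
    rw [eps_succ, hw, map_add, map_sum, map_smul, smul_eq_mul]
    have e1 : ∑ d ∈ range D, t ^ d * UU q (r+1) d φ =
        ∑ e ∈ range D, ∑ d ∈ range (D - e), t ^ e * (t ^ d * UU q r d (fe q r e φ)) := by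
      rw [← sum_range_diag_flip]
      refine sum_congr rfl fun d _ => ?_
      rw [UU_succ, Nat.sum_antidiagonal_eq_sum_range_succ_mk, mul_sum]
      refine sum_congr rfl fun e he => ?_
      rw [mem_range] at he
      rw [← mul_assoc, ← pow_add]
      have : e + (d - e) = d := by omega
      rw [this]
    rw [e1, add_sub_right_comm, ← sum_sub_distrib]
    refine dvd_add (dvd_sum fun e he => ?_) (dvd_mul_right _ _)
    rw [mem_range] at he
    rw [map_smul, smul_eq_mul, ← mul_sum, ← mul_sub]
    have : D = e + (D - e) := by omega
    conv_lhs => rw [this, pow_add]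
    exact mul_dvd_mul_left _ (ih _ _)

lemma UU_ph (r m d : ℕ) : UU q r d (ph m (r+1)) = ∑ c ∈ Idx r d, aa q r m c c := rfl

end

/-- Dyck condition -/
def Dy (r m : ℕ) (c : ℕ →₀ ℕ) : Prop := ∀ i < r + 1, c i ≤ cns c i + m
instance (r m c) : Decidable (Dy r m c) := by unfold Dy; infer_instance
/-- statistic -/
def dst (r m : ℕ) (c : ℕ →₀ ℕ) : ℕ := ds (r+1) c (fun i => cns c i + m)

/-- the count -/
def cnt (r m u v : ℕ) : ℕ := #{c ∈ Idx r v | Dy r m c ∧ dst r m c = u}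

lemma X_dvd_coeff {i : Fin 2} {D : ℕ} {p : MvPolynomial (Fin 2) ℤ} (h : X i ^ D ∣ p)
    (e : Fin 2 →₀ ℕ) (he : e i < D) : coeff e p = 0 := by
  obtain ⟨w, rfl⟩ := h
  rw [mul_comm, X_pow_eq_monomial, coeff_mul_monomial', if_neg]
  intro h2
  have := h2 i
  rw [Finsupp.single_eq_same] at this; omega

lemma extract (r m : ℕ) (i j : Fin 2) (hij : i ≠ j) (e : Fin 2 →₀ ℕ) :
    coeff e (eps (TH (X i : MvPolynomial (Fin 2) ℤ) (X j)) (r+1) (ph m (r+1))) =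
      cnt r m (e i) (e j) := by
  have h := unroll (X i : MvPolynomial (Fin 2) ℤ) (X j) r (e j + 1) (ph m (r+1))
  have h2 := X_dvd_coeff h e (by omega)
  rw [coeff_sub, sub_eq_zero] at h2
  rw [h2, coeff_sum]
  have hT : ∀ d, UU (X i : MvPolynomial (Fin 2) ℤ) r d (ph m (r+1)) =
      ∑ c ∈ Idx r d, if Dy r m c then (X i : MvPolynomial (Fin 2) ℤ) ^ dst r m c else 0 := by
    intro d
    rw [UU_ph, trace_eq (X i) (eval (fun _ => (1:ℤ))) (by simp)]
    rfl
  have hm : ∀ d s : ℕ, coeff e ((X j : MvPolynomial (Fin 2) ℤ) ^ d * X i ^ s) =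
      if d = e j ∧ s = e i then 1 else 0 := by
    intro d s
    rw [X_pow_eq_monomial, X_pow_eq_monomial, monomial_mul, coeff_monomial, one_mul]
    refine if_congr ?_ rfl rfl
    constructor
    · rintro rfl
      simp [Finsupp.single_apply, hij, hij.symm]
    · rintro ⟨rfl, rfl⟩
      ext l
      have : l = i ∨ l = j := by omega
      rcases this with rfl | rfl <;> simp [Finsupp.single_apply, hij, hij.symm]
  have hc : ∀ d, coeff e ((X j : MvPolynomial (Fin 2) ℤ) ^ d *
      UU (X i : MvPolynomial (Fin 2) ℤ) r d (ph m (r+1))) =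
      if d = e j then (cnt r m (e i) (e j) : ℤ) else 0 := by
    intro d
    rw [hT, mul_sum, coeff_sum]
    have : ∀ c, coeff e ((X j : MvPolynomial (Fin 2) ℤ) ^ d *
      (if Dy r m c then (X i : MvPolynomial (Fin 2) ℤ) ^ dst r m c else 0)) =
      if d = e j then (if Dy r m c ∧ dst r m c = e i then 1 else 0) else 0 := by
      intro c
      by_cases h1 : Dy r m c
      · rw [if_pos h1, hm]
        simp only [h1, true_and]
        rw [ite_and]
      · simp [h1]
    simp only [this]
    split_ifs with h
    · subst h
      rw [cnt, card_filter]; push_cast; rfl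
    · simp
  simp only [hc]
  rw [sum_ite_eq', if_pos (by simp)]

theorem cnt_symm (r m u v : ℕ) : cnt r m u v = cnt r m v u := by
  let e : Fin 2 →₀ ℕ := Finsupp.single 0 u + Finsupp.single 1 v
  have h1 := extract r m 0 1 (by decide) e
  have h2 := extract r m 1 0 (by decide) e
  rw [TH_symm, h2] at h1
  have e0 : e 0 = u := by simp [e]
  have e1 : e 1 = v := by simp [e]
  rw [e0, e1] at h1
  exact_mod_cast h1.symm
end QT

namespace QT

/-- overlap length -/
def ov (m : ℕ) (A : ℕ → ℕ) (i l : ℕ) : ℕ :=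
  min (A i + m) (A l + m + 1) - max (A (i+1)) (A (l+1))

/-- correction -/
def Wc (m : ℕ) (A : ℕ → ℕ) (i k : ℕ) : ℤ :=
  (min (A (i+1)) (A k) : ℤ) - 1 - min ((A i : ℤ) + m - 1) ((A k : ℤ) - 1)

/-- telescoping -/
def gc (m : ℕ) (A : ℕ → ℕ) (k i : ℕ) : ℤ :=
  (min (A i) (A k) : ℤ) - 1 - min ((A i : ℤ) - 1) ((A k : ℤ) + m)

lemma ov_point (m : ℕ) (A : ℕ → ℕ) (i k : ℕ) (hi : A (i+1) ≤ A i + m) (hk : A (k+1) ≤ A k + m) :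
    (ov m A i k : ℤ) = scm m (A i - A k) + (Wc m A i (k+1) - Wc m A i k) +
      (gc m A k (i+1) - gc m A k i) := by
  unfold ov Wc gc scm
  split_ifs <;> omega

lemma ov_sum (m : ℕ) (A : ℕ → ℕ) (h0 : A 0 = 0) (n : ℕ) (h : ∀ i < n, A (i+1) ≤ A i + m) :
    ∑ j ∈ range n, ∑ i ∈ range j, (ov m A i j : ℤ) =
      ∑ j ∈ range n, ∑ i ∈ range j, scm m (A i - A j) + ∑ i ∈ range n, Wc m A i n := by
  induction n with
  | zero => simp
  | succ k ih =>
    rw [sum_range_succ, sum_range_succ (fun j => ∑ i ∈ range j, scm m (A i - A j)),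
      sum_range_succ (fun i => Wc m A i (k+1)), ih (fun i hi => h i (by omega))]
    have h1 : ∑ i ∈ range k, (ov m A i k : ℤ) = ∑ i ∈ range k, scm m (A i - A k) +
      (∑ i ∈ range k, Wc m A i (k+1) - ∑ i ∈ range k, Wc m A i k) +
      (gc m A k k - gc m A k 0) := by
      rw [← sum_range_sub, ← sum_sub_distrib, ← sum_add_distrib, ← sum_add_distrib]
      refine sum_congr rfl fun i hi => ?_
      rw [mem_range] at hi
      exact ov_point m A i k (h i (by omega)) (h k (by omega))
    have h2 : Wc m A k (k+1) = 0 := by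
      have := h k (by omega)
      unfold Wc; omega
    have h3 : gc m A k k - gc m A k 0 = 0 := by
      unfold gc; rw [h0]; omega
    rw [h1, h2, h3]; ring

lemma dst_eq (r m : ℕ) (c : ℕ →₀ ℕ) (hc : ∀ i, r ≤ i → c i = 0) (hD : Dy r m c) :
    (dst r m c : ℤ) = dinvm (r+1) m (fun i => (cns c i : ℤ)) := by
  have hA : ∀ i, cns c (i+1) = c i := fun i => by simp [cns]
  have e1 := ov_sum m (cns c) rfl (r+1) (fun i hi => by rw [hA]; exact hD i hi)
  have e2 : ∑ i ∈ range (r+1), Wc m (cns c) i (r+1) = 0 := by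
    apply sum_eq_zero; intro i _
    unfold Wc; rw [hA r, hc r le_rfl]; omega
  rw [e2, add_zero] at e1
  have e3 : (dst r m c : ℤ) = ∑ j ∈ range (r+1), ∑ i ∈ range j, (ov m (cns c) i j : ℤ) := by
    unfold dst ds ps
    rw [sum_comm]; push_cast
    refine sum_congr rfl fun j hj => ?_
    rw [mem_range] at hj
    rw [← sum_filter]
    have : (range (r+1)).filter (· < j) = range j := by ext i; simp; omega
    rw [this]
    refine sum_congr rfl fun i _ => ?_
    unfold ov; rw [hA, hA]
  rw [e3, e1]
  unfold dinvm
  rw [← Fin.sum_univ_eq_sum_range (fun j => ∑ i ∈ range j, scm m (cns c i - cns c j)) (r+1)]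
  refine sum_congr rfl fun j _ => ?_
  symm
  refine sum_bij (fun i _ => i.1) ?_ ?_ ?_ ?_
  · intro i hi; simpa using hi
  · intro a _ b _ h; exact Fin.ext h
  · intro b hb
    rw [mem_range] at hb
    exact ⟨⟨b, by omega⟩, by rw [mem_filter]; exact ⟨mem_univ _, hb⟩, rfl⟩
  · intro i _; rfl

lemma area_eq (r : ℕ) (c : ℕ →₀ ℕ) :
    aream (r+1) (fun i => (cns c i : ℤ)) = ((∑ i ∈ range r, c i : ℕ) : ℤ) := by
  unfold aream
  rw [Fin.sum_univ_eq_sum_range (fun i => (cns c i : ℤ)), sum_range_succ']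
  simp [cns]

lemma cnt_eq (r m : ℕ) (L : Finset (Fin (r+1) → ℤ))
    (hL : ∀ a : Fin (r+1) → ℤ, a ∈ L ↔
      (a ⟨0, by omega⟩ = 0 ∧ ∀ i : ℕ, ∀ hi : i + 1 < r+1,
        0 ≤ a ⟨i + 1, hi⟩ ∧ a ⟨i + 1, hi⟩ ≤ a ⟨i, by omega⟩ + (m : ℤ)))
    (u v : ℕ) :
    (L.filter (fun a => dinvm (r+1) m a = (u : ℤ) ∧ aream (r+1) a = (v : ℤ))).card = cnt r m u v := by
  unfold cnt
  symm
  refine card_bij (fun c _ => fun i : Fin (r+1) => (cns c i : ℤ)) ?_ ?_ ?_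
  · intro c hc
    simp only [mem_filter, mem_Idx] at hc
    obtain ⟨⟨h1, h2⟩, h3, h4⟩ := hc
    rw [mem_filter, hL]
    refine ⟨⟨by simp [cns], ?_⟩, ?_, ?_⟩
    · intro i hi
      refine ⟨by positivity, ?_⟩
      have := h3 i (by omega)
      have e : cns c (i+1) = c i := by simp [cns]
      show ((cns c (i+1) : ℕ) : ℤ) ≤ (cns c i : ℤ) + m
      rw [e]; exact_mod_cast this
    · rw [← dst_eq r m c h2 h3, h4]
    · rw [area_eq, h1]
  · intro c hc c' hc' h
    simp only [mem_filter, mem_Idx] at hc hc'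
    ext i
    by_cases hi : i < r
    · have := congrFun h ⟨i+1, by omega⟩
      simpa [cns] using this
    · rw [hc.1.2 i (by omega), hc'.1.2 i (by omega)]
  · intro a ha
    rw [mem_filter, hL] at ha
    obtain ⟨⟨h1, h2⟩, h3, h4⟩ := ha
    let f : ℕ → ℕ := fun i => if h : i < r then (a ⟨i+1, by omega⟩).toNat else 0
    let c : ℕ →₀ ℕ := Finsupp.onFinset (range r) f
      (by intro i hi; rw [mem_range]; by_contra h; simp [f, h] at hi)
    have hc : ∀ i, r ≤ i → c i = 0 := by
      intro i hi
      show f i = 0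
      simp only [f]; rw [dif_neg (by omega)]
    have hcs : ∀ i (hi : i < r), (c i : ℤ) = a ⟨i+1, by omega⟩ := by
      intro i hi
      show (f i : ℤ) = _
      simp only [f]; rw [dif_pos hi]
      exact Int.toNat_of_nonneg (h2 i (by omega)).1
    have hca : (fun i : Fin (r+1) => (cns c i : ℤ)) = a := by
      funext i
      obtain ⟨i, hi⟩ := i
      cases i with
      | zero => simp [cns]; exact h1.symm
      | succ i =>
        have e : cns c (i+1) = c i := by simp [cns]
        show ((cns c (i+1) : ℕ) : ℤ) = _
        rw [e]; exact hcs i (by omega)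
    have hD : Dy r m c := by
      intro i hi
      by_cases h : i < r
      · have h5 := (h2 i (by omega)).2
        rw [← hcs i h] at h5
        have h6 : ((cns c i : ℕ) : ℤ) = a ⟨i, by omega⟩ := congrFun hca ⟨i, by omega⟩
        rw [← h6] at h5
        exact_mod_cast h5
      · rw [hc i (by omega)]; omega
    refine ⟨c, ?_, hca⟩
    rw [mem_filter, mem_Idx]
    refine ⟨⟨?_, hc⟩, hD, ?_⟩
    · rw [← hca, area_eq] at h4; exact_mod_cast h4
    · rw [← hca, ← dst_eq r m c hc hD] at h3; exact_mod_cast h3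

end QT

/-- Joint symmetry of the combinatorial higher q,t-Catalan numbers: the number of m-Dyck
paths with `dinv_m = u` and `area_m = v` equals the number with `dinv_m = v` and
`area_m = u`. -/
theorem higher_qt_catalan_symmetric (m n : ℕ) (hm : 1 ≤ m) (hn : 1 ≤ n)
    (L : Finset (Fin n → ℤ))
    (hL : ∀ a : Fin n → ℤ, a ∈ L ↔
      (a ⟨0, by omega⟩ = 0 ∧ ∀ i : ℕ, ∀ hi : i + 1 < n,
        0 ≤ a ⟨i + 1, hi⟩ ∧ a ⟨i + 1, hi⟩ ≤ a ⟨i, by omega⟩ + (m : ℤ)))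
    (u v : ℕ) :
    (L.filter (fun a => dinvm n m a = (u : ℤ) ∧ aream n a = (v : ℤ))).card =
      (L.filter (fun a => dinvm n m a = (v : ℤ) ∧ aream n a = (u : ℤ))).card := by
  obtain ⟨r, rfl⟩ : ∃ r, n = r + 1 := ⟨n - 1, by omega⟩
  rw [QT.cnt_eq r m L hL u v, QT.cnt_eq r m L hL v u]
  exact QT.cnt_symm r m u v
end

section
/- The map f restricts to a bijection from the bounce polytope B_n onto the area polytope A_n; that is, for every a ∈ A_n there exists a unique b ∈ B_n with f(b) = a. (Equivalently, the map sending the bounce vector of a continuous Dyck path to the area vector of the same path is a bijection B_n → A_n.) -/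
open MeasureTheory Finset Filter

noncomputable section

/-- `sc x = max (1 - |x|) 0`. -/
def sc (x : ℝ) : ℝ := max (1 - |x|) 0

/-- Extend `a : Fin k → ℝ` (thought of as coordinates `a_1, …, a_k`) to an ℕ-indexed
vector with the convention `a_0 = 0` (and value `0` beyond index `k`). -/
def cext {k : ℕ} (a : Fin k → ℝ) (i : ℕ) : ℝ :=
  if h : 1 ≤ i ∧ i ≤ k then a ⟨i - 1, by omega⟩ else 0

/-- The area polytope `A_n ⊆ ℝ^{n-1}`. -/
def areaPoly (n : ℕ) : Set (Fin (n - 1) → ℝ) :=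
  {a | ∀ i < n - 1, 0 ≤ cext a (i + 1) ∧ cext a (i + 1) ≤ cext a i + 1}

/-- The bounce polytope `B_n ⊆ ℝ^{n-1}`. -/
def bouncePoly (n : ℕ) : Set (Fin (n - 1) → ℝ) :=
  {b | ∀ i < n - 1, cext b i ≤ cext b (i + 1) ∧ cext b (i + 1) ≤ cext b i + 1}

/-- `area(a) = ∑_{i=0}^{n-1} a_i`. -/
def area (n : ℕ) (a : Fin (n - 1) → ℝ) : ℝ := ∑ i ∈ Finset.range n, cext a i

/-- `dinv(a) = ∑_{0 ≤ i < j ≤ n-1} sc(a_i - a_j)`. -/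
def dinv (n : ℕ) (a : Fin (n - 1) → ℝ) : ℝ :=
  ∑ j ∈ Finset.range n, ∑ i ∈ Finset.range j, sc (cext a i - cext a j)

/-- The `q,t`-Catalan measure `μ_n`: pushforward of Lebesgue measure restricted to `A_n`
under `a ↦ (dinv a, area a)`. -/
def qtMeasure (n : ℕ) : Measure (ℝ × ℝ) :=
  Measure.map (fun a => (dinv n a, area n a)) (volume.restrict (areaPoly n))

/-- The map `f` with `f(b)_j = ∑_{i=0}^{j-1} sc(b_j - b_i)` (convention `b_0 = 0`). -/
def fmap (n : ℕ) (b : Fin (n - 1) → ℝ) : Fin (n - 1) → ℝ :=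
  fun j => ∑ i ∈ Finset.range (j.1 + 1), sc (cext b (j.1 + 1) - cext b i)

def Fseq (c : ℕ → ℝ) (j : ℕ) (x : ℝ) : ℝ := ∑ i ∈ Finset.range j, sc (x - c i)

lemma sc_anti {x y : ℝ} (hx : 0 ≤ x) (h : x ≤ y) : sc y ≤ sc x := by
  unfold sc
  rw [abs_of_nonneg hx, abs_of_nonneg (hx.trans h)]
  exact max_le_max (by linarith) le_rfl

lemma sc_nonneg (x : ℝ) : 0 ≤ sc x := le_max_right _ _

lemma sc_zero : sc 0 = 1 := by simp [sc]

lemma sc_big {x : ℝ} (h : 1 ≤ x) : sc x = 0 := by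
  unfold sc
  rw [abs_of_nonneg (by linarith)]
  exact max_eq_right (by linarith)

lemma sc_small {x : ℝ} (h0 : 0 ≤ x) (h : x ≤ 1) : sc x = 1 - x := by
  unfold sc
  rw [abs_of_nonneg h0]
  exact max_eq_left (by linarith)

lemma sc_cont : Continuous sc := by unfold sc; fun_prop

lemma Fseq_cont (c : ℕ → ℝ) (j : ℕ) : Continuous (Fseq c j) := by
  unfold Fseq
  exact continuous_finset_sum _ fun i _ => sc_cont.comp (by fun_prop)

lemma Fseq_nonneg (c : ℕ → ℝ) (j : ℕ) (x : ℝ) : 0 ≤ Fseq c j x :=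
  Finset.sum_nonneg fun _ _ => sc_nonneg _

lemma Fseq_succ (c : ℕ → ℝ) (j : ℕ) (x : ℝ) :
    Fseq c (j + 1) x = Fseq c j x + sc (x - c j) := Finset.sum_range_succ _ _

lemma Fseq_self (c : ℕ → ℝ) (j : ℕ) : Fseq c (j + 1) (c j) = Fseq c j (c j) + 1 := by
  rw [Fseq_succ, sub_self, sc_zero]

lemma Fseq_top (c : ℕ → ℝ) (j : ℕ) (hc : ∀ i ≤ j, c i ≤ c j) :
    Fseq c (j + 1) (c j + 1) = 0 := by
  refine Finset.sum_eq_zero fun i hi => sc_big ?_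
  have := hc i (by simpa [Nat.lt_succ_iff] using hi)
  linarith

lemma Fseq_anti (c : ℕ → ℝ) (j k : ℕ) (hk : k ≤ j + 1) (hc : ∀ i ≤ j, c i ≤ c j) {x y : ℝ}
    (hx : c j ≤ x) (h : x ≤ y) : Fseq c k y ≤ Fseq c k x := by
  refine Finset.sum_le_sum fun i hi => sc_anti ?_ (by linarith)
  have := hc i (by have := Finset.mem_range.1 hi; omega)
  linarith

lemma Fseq_strict (c : ℕ → ℝ) (j : ℕ) (hc : ∀ i ≤ j, c i ≤ c j) {x y : ℝ}
    (hx : c j ≤ x) (h : x < y) (hy : y ≤ c j + 1) : Fseq c (j + 1) y < Fseq c (j + 1) x := by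
  rw [Fseq_succ, Fseq_succ, sc_small (by linarith) (by linarith),
    sc_small (by linarith) (by linarith)]
  have := Fseq_anti c j j (by omega) hc hx h.le
  linarith

lemma Fseq_congr {c d : ℕ → ℝ} {j : ℕ} (h : ∀ i < j, c i = d i) (x : ℝ) :
    Fseq c j x = Fseq d j x :=
  Finset.sum_congr rfl fun i hi => by rw [h i (Finset.mem_range.1 hi)]

lemma seq_mono (c : ℕ → ℝ) (m : ℕ) (h : ∀ i < m, c i ≤ c (i + 1)) :
    ∀ j ≤ m, ∀ i ≤ j, c i ≤ c j := by
  intro j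
  induction j with
  | zero => intro _ i hi; rw [Nat.le_zero.1 hi]
  | succ j ih =>
    intro hj i hi
    rcases Nat.lt_or_eq_of_le hi with h1 | h1
    · exact (ih (by omega) i (by omega)).trans (h j (by omega))
    · rw [h1]

lemma seq_exists (a : ℕ → ℝ) (a0 : a 0 = 0) (m : ℕ)
    (h : ∀ i < m, 0 ≤ a (i + 1) ∧ a (i + 1) ≤ a i + 1) :
    ∃ b : ℕ → ℝ, b 0 = 0 ∧ (∀ i < m, b i ≤ b (i + 1) ∧ b (i + 1) ≤ b i + 1) ∧
      ∀ i ≤ m, Fseq b i (b i) = a i := by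
  induction m with
  | zero =>
    refine ⟨fun _ => 0, rfl, by simp, fun i hi => ?_⟩
    rw [Nat.le_zero.1 hi, a0]; simp [Fseq]
  | succ m ih =>
    obtain ⟨b, b0, hb, hF⟩ := ih fun i hi => h i (by omega)
    have hm := seq_mono b m (fun i hi => (hb i hi).1) m le_rfl
    have hiv := intermediate_value_Icc' (show b m ≤ b m + 1 by linarith)
      (Fseq_cont b (m + 1)).continuousOn
    rw [Fseq_self, Fseq_top b m hm, hF m le_rfl] at hiv
    obtain ⟨x, hx, hxa⟩ := hiv (h m (by omega))
    have hne : ∀ i ≤ m, (fun i => if i = m + 1 then x else b i) i = b i := by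
      intro i hi
      exact if_neg (by omega)
    have heq : (fun i => if i = m + 1 then x else b i) (m + 1) = x := if_pos rfl
    generalize (fun i => if i = m + 1 then x else b i) = d at hne heq
    refine ⟨d, by rw [hne 0 (by omega), b0], fun i hi => ?_, fun i hi => ?_⟩
    · rcases Nat.lt_or_eq_of_le (Nat.lt_succ_iff.1 hi) with h1 | rfl
      · rw [hne i (by omega), hne (i + 1) (by omega)]; exact hb i h1
      · rw [hne i le_rfl, heq]; exact hx
    · rw [Fseq_congr (d := b) fun k hk => hne k (by omega)]
      rcases Nat.lt_or_eq_of_le hi with h1 | rfl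
      · rw [hne i (by omega)]; exact hF i (by omega)
      · rw [heq, hxa]

lemma seq_unique (b d : ℕ → ℝ) (h0 : b 0 = d 0) (m : ℕ)
    (hb : ∀ i < m, b i ≤ b (i + 1) ∧ b (i + 1) ≤ b i + 1)
    (hd : ∀ i < m, d i ≤ d (i + 1) ∧ d (i + 1) ≤ d i + 1)
    (hF : ∀ i ≤ m, Fseq b i (b i) = Fseq d i (d i)) : ∀ i ≤ m, b i = d i := by
  intro i
  induction i using Nat.strong_induction_on with
  | _ i ih =>
    intro hi
    rcases i with _ | j
    · exact h0
    have e := hF (j + 1) hi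
    rw [← Fseq_congr (c := b) (d := d) fun k hk => ih k hk (by omega)] at e
    have hm := seq_mono b m (fun i hi => (hb i hi).1) j (by omega)
    have h1 := hb j (by omega)
    have h2 := hd j (by omega)
    rw [← ih j (by omega) (by omega)] at h2
    rcases lt_trichotomy (b (j + 1)) (d (j + 1)) with h | h | h
    · have := Fseq_strict b j hm h1.1 h h2.2
      linarith
    · exact h
    · have := Fseq_strict b j hm h2.1 h h1.2
      linarith

lemma cext_zero {k : ℕ} (a : Fin k → ℝ) : cext a 0 = 0 := by simp [cext]

lemma cext_succ {k : ℕ} (a : Fin k → ℝ) (i : ℕ) (hi : i < k) : cext a (i + 1) = a ⟨i, hi⟩ := by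
  unfold cext
  rw [dif_pos ⟨by omega, by omega⟩]
  rfl

lemma cext_fmap (n : ℕ) (b : Fin (n - 1) → ℝ) (i : ℕ) (hi : i ≤ n - 1) :
    cext (fmap n b) i = Fseq (cext b) i (cext b i) := by
  rcases i with _ | i
  · simp [cext_zero, Fseq]
  · rw [cext_succ _ i (by omega)]; rfl

/-- `f` restricts to a bijection from the bounce polytope `B_n` onto the area polytope
`A_n`: it maps `B_n` into `A_n`, and every `a ∈ A_n` has a unique preimage `b ∈ B_n`. -/
theorem fmap_bijOn (n : ℕ) (hn : 2 ≤ n) :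
    (∀ b ∈ bouncePoly n, fmap n b ∈ areaPoly n) ∧
    ∀ a ∈ areaPoly n, ∃! b, b ∈ bouncePoly n ∧ fmap n b = a := by
  refine ⟨fun b hb i hi => ?_, fun a ha => ?_⟩
  · have hm := seq_mono (cext b) (n - 1) (fun i hi => (hb i hi).1) i hi.le
    rw [cext_fmap n b _ hi, cext_fmap n b i hi.le]
    refine ⟨Fseq_nonneg _ _ _, ?_⟩
    rw [← Fseq_self]
    exact Fseq_anti _ i _ le_rfl hm le_rfl (hb i hi).1
  · obtain ⟨c, c0, hc, hF⟩ := seq_exists (cext a) (cext_zero a) (n - 1) ha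
    have hcb : ∀ i ≤ n - 1, cext (fun j : Fin (n - 1) => c (j.1 + 1)) i = c i := by
      intro i hi
      rcases i with _ | i
      · rw [cext_zero, c0]
      · rw [cext_succ _ i (by omega)]
    refine ⟨fun j => c (j.1 + 1), ⟨fun i hi => ?_, ?_⟩, ?_⟩
    · rw [hcb i hi.le, hcb (i + 1) hi]; exact hc i hi
    · funext j
      rw [← cext_succ (fmap n _) j.1 j.2, ← cext_succ a j.1 j.2, cext_fmap n _ _ j.2,
        ← hF _ j.2, hcb _ j.2]
      exact Fseq_congr (fun i hi => hcb i (by have := j.2; omega)) _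
    · rintro d ⟨hd, hfd⟩
      funext j
      rw [← cext_succ d j.1 j.2]
      refine seq_unique (cext d) c (by rw [cext_zero, c0]) (n - 1) hd hc (fun i hi => ?_) _ j.2
      rw [← cext_fmap n d i hi, hfd, hF i hi]
end
end

section
/- The dinv and area statistics on m-Dyck paths have the same univariate distribution: for all integers m, n ≥ 1 and every natural number k, the number of vectors a ∈ L with dinv_m(a) = k equals the number of vectors a ∈ L with area_m(a) = k. Equivalently, ∑_{a ∈ L} q^{dinv_m(a)} = ∑_{a ∈ L} q^{area_m(a)} as polynomials in q. -/
open Finset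

namespace DA

def A (m : ℕ) (s : ℤ) (l : List ℤ) : ℤ := (l.map (fun x => max 0 ((m : ℤ) + x - s))).sum

def T (m : ℕ) (u : List ℤ) (s : ℤ) (w : List ℤ) : ℤ := A m s u + A m (s - 1) w

def Valid (m : ℕ) (l : List ℤ) : Prop :=
  l.head? = some 0 ∧ (∀ x ∈ l, 0 ≤ x) ∧ l.IsChain (fun x y => y ≤ x + (m : ℤ))

def Ins (m : ℕ) (u : List ℤ) (s : ℤ) (w : List ℤ) : Prop :=
  (∃ g, u.getLast? = some g ∧ s ≤ g + (m : ℤ)) ∧ (∀ x ∈ u, x ≤ s) ∧ (∀ x ∈ w, x < s)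

def dinvL (m : ℕ) : List ℤ → ℤ
  | [] => 0
  | x :: l => (l.map (fun y => scm m (x - y))).sum + dinvL m l

lemma A_append (m : ℕ) (s : ℤ) (l l' : List ℤ) : A m s (l ++ l') = A m s l + A m s l' := by
  simp [A]

lemma A_cons (m : ℕ) (s x : ℤ) (l : List ℤ) :
    A m s (x :: l) = max 0 ((m : ℤ) + x - s) + A m s l := by
  simp [A]

lemma A_nonneg (m : ℕ) (s : ℤ) (l : List ℤ) : 0 ≤ A m s l := by
  induction l with
  | nil => simp [A]
  | cons x l ih => rw [A_cons]; omega

lemma A_anti (m : ℕ) {s s' : ℤ} (h : s ≤ s') (l : List ℤ) : A m s' l ≤ A m s l := by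
  induction l with
  | nil => simp [A]
  | cons x l ih => rw [A_cons, A_cons]; omega

lemma A_strict (m : ℕ) {s g : ℤ} (l : List ℤ) (hg : g ∈ l) (h : s ≤ g + (m : ℤ)) :
    A m s l < A m (s - 1) l := by
  induction l with
  | nil => simp at hg
  | cons x l ih =>
    rw [A_cons, A_cons]
    have h2 := A_anti m (show s - 1 ≤ s by omega) l
    rcases List.mem_cons.1 hg with rfl | hg
    · omega
    · have := ih hg
      omega

lemma T_ge (m : ℕ) (u : List ℤ) (s : ℤ) (w : List ℤ) : A m s (u ++ w) ≤ T m u s w := by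
  have h2 := A_anti m (show s - 1 ≤ s by omega) w
  rw [A_append, T]; omega

lemma T_le (m : ℕ) (u : List ℤ) (s : ℤ) (w : List ℤ) : T m u s w ≤ A m (s - 1) (u ++ w) := by
  have h2 := A_anti m (show s - 1 ≤ s by omega) u
  rw [A_append, T]; omega

lemma T_nonneg (m : ℕ) (u : List ℤ) (s : ℤ) (w : List ℤ) : 0 ≤ T m u s w := by
  have := A_nonneg m s u
  have := A_nonneg m (s-1) w
  rw [T]; omega

lemma T_lt (m : ℕ) (u : List ℤ) (s : ℤ) (w : List ℤ) (h : Ins m u s w) :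
    T m u s w < A m (s - 1) (u ++ w) := by
  obtain ⟨⟨g, hg, hs⟩, -, -⟩ := h
  have := A_strict m u (List.mem_of_getLast? hg) hs
  rw [A_append, T]; omega

lemma T_split (m : ℕ) (u a w : List ℤ) (s : ℤ) :
    T m (u ++ a) s w ≤ T m u s (a ++ w) := by
  have h2 := A_anti m (show s - 1 ≤ s by omega) a
  rw [T, T, A_append, A_append]; omega

lemma T_split_lt (m : ℕ) (u a w : List ℤ) (s : ℤ) (ha : a ≠ []) (h : Ins m (u ++ a) s w) :
    T m (u ++ a) s w < T m u s (a ++ w) := by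
  obtain ⟨⟨g, hg, hs⟩, -, -⟩ := h
  rw [List.getLast?_append_of_ne_nil _ ha] at hg
  have := A_strict m a (List.mem_of_getLast? hg) hs
  rw [T, T, A_append, A_append]; omega

lemma T_slt (m : ℕ) {u w u' w' : List ℤ} {s s' : ℤ} (he : u ++ w = u' ++ w')
    (h' : Ins m u' s' w') (hs : s < s') : T m u' s' w' < T m u s w := by
  have h1 := T_lt m _ _ _ h'
  have h2 := T_ge m u s w
  have h3 := A_anti m (show s ≤ s' - 1 by omega) (u ++ w)
  rw [← he] at h1
  omega

lemma T_inj (m : ℕ) {u w u' w' : List ℤ} {s s' : ℤ} (he : u ++ w = u' ++ w')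
    (h : Ins m u s w) (h' : Ins m u' s' w') (ht : T m u s w = T m u' s' w') :
    u ++ s :: w = u' ++ s' :: w' := by
  rcases lt_trichotomy s s' with hs | rfl | hs
  · have := T_slt m he h' hs; omega
  · rcases List.append_eq_append_iff.1 he with ⟨a, rfl, rfl⟩ | ⟨a, rfl, rfl⟩
    · by_cases ha : a = []
      · subst ha; simp
      · have := T_split_lt m u a w' s ha h'; omega
    · by_cases ha : a = []
      · subst ha; simp
      · have := T_split_lt m u' a w s ha h; omega
  · have := T_slt m he.symm h hs; omega

lemma T_step (m : ℕ) {u w u' w' : List ℤ} {s s' : ℤ} (he : u ++ s :: w = u' ++ w')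
    (h : Ins m u s w) (h' : Ins m u' s' w') : T m u' s' w' ≤ T m u s w + m := by
  have h0 : T m (u ++ [s]) s w = T m u s w + m := by
    rw [T, T, A_append, A_cons]; simp [A]; ring
  have he' : (u ++ [s]) ++ w = u' ++ w' := by simpa using he
  have hmem : s ∈ u' ++ w' := by rw [← he]; simp
  have hss : s ≤ s' := by
    rcases List.mem_append.1 hmem with hh | hh
    · exact h'.2.1 _ hh
    · exact (h'.2.2 _ hh).le
  rcases hss.lt_or_eq with hs | rfl
  · have := T_slt m he' h' hs; omega
  · rcases List.append_eq_append_iff.1 he' with ⟨a, rfl, rfl⟩ | ⟨a, h1, rfl⟩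
    · have := T_split m (u ++ [s]) a w' s; omega
    · by_cases ha : a = []
      · subst ha
        simp only [List.append_nil] at h1
        subst h1
        simp only [List.nil_append]; omega
      · exfalso
        have h2 : s ∈ a := by
          have h3 : (u ++ [s]).getLast? = some s := by simp
          rw [h1, List.getLast?_append_of_ne_nil _ ha] at h3
          exact List.mem_of_getLast? h3
        have := h'.2.2 s (by simp [h2])
        omega

lemma dinvL_insert (m : ℕ) (u : List ℤ) (s : ℤ) (w : List ℤ) :
    dinvL m (u ++ s :: w) = dinvL m (u ++ w) + (u.map (fun x => scm m (x - s))).sum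
      + (w.map (fun y => scm m (s - y))).sum := by
  induction u with
  | nil => simp [dinvL]; ring
  | cons x u ih => simp [dinvL, ih]; ring

lemma dinvL_T (m : ℕ) (u : List ℤ) (s : ℤ) (w : List ℤ) (hu : ∀ x ∈ u, x ≤ s)
    (hw : ∀ x ∈ w, x < s) : dinvL m (u ++ s :: w) = dinvL m (u ++ w) + T m u s w := by
  rw [dinvL_insert, T, A, A, add_assoc]
  congr 2
  · congr 1
    apply List.map_congr_left
    intro x hx
    have := hu x hx
    unfold scm
    split_ifs <;> omega
  · congr 1
    apply List.map_congr_left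
    intro x hx
    have := hw x hx
    unfold scm
    split_ifs <;> omega

lemma exists_last_max (l : List ℤ) (hl : l ≠ []) :
    ∃ u s w, l = u ++ s :: w ∧ (∀ x ∈ u, x ≤ s) ∧ (∀ x ∈ w, x < s) := by
  induction l with
  | nil => simp at hl
  | cons x l ih =>
    by_cases h : l = []
    · subst h
      exact ⟨[], x, [], by simp, by simp, by simp⟩
    · obtain ⟨u, s, w, rfl, hu, hw⟩ := ih h
      by_cases hx : x ≤ s
      · refine ⟨x :: u, s, w, by simp, ?_, hw⟩
        intro y hy
        rcases List.mem_cons.1 hy with rfl | hy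
        · exact hx
        · exact hu _ hy
      · refine ⟨[], x, u ++ s :: w, by simp, by simp, ?_⟩
        intro y hy
        simp only [List.mem_append, List.mem_cons] at hy
        rcases hy with hy | rfl | hy
        · have := hu _ hy; omega
        · omega
        · have := hw _ hy; omega

lemma decomp (m : ℕ) (l : List ℤ) (hl : 2 ≤ l.length) (hv : Valid m l) :
    ∃ u s w, l = u ++ s :: w ∧ Ins m u s w ∧ Valid m (u ++ w) := by
  obtain ⟨u, s, w, rfl, hu, hw⟩ := exists_last_max l (by rintro rfl; simp at hl)
  obtain ⟨h0, hn, hc⟩ := hv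
  rcases List.eq_nil_or_concat u with rfl | ⟨v, g, rfl⟩
  · exfalso
    simp at h0
    subst h0
    cases w with
    | nil => simp at hl
    | cons y w =>
      have := hw y (by simp)
      have := hn y (by simp)
      omega
  · have hc' : List.IsChain (fun x y => y ≤ x + (m : ℤ)) (v ++ g :: s :: w) := by simpa using hc
    rw [List.isChain_append_cons_cons] at hc'
    obtain ⟨c1, c2, c3⟩ := hc'
    refine ⟨_, s, w, rfl, ⟨⟨g, by simp, c2⟩, hu, hw⟩, ?_, ?_, ?_⟩
    · cases v <;> simpa using h0
    · intro x hx
      apply hn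
      simp only [List.mem_append, List.mem_cons] at hx ⊢
      tauto
    · cases w with
      | nil => simpa using c1
      | cons y w =>
        have : List.IsChain (fun x y => y ≤ x + (m : ℤ)) (v ++ g :: y :: w) := by
          rw [List.isChain_append_cons_cons]
          refine ⟨c1, ?_, (List.isChain_cons_cons.1 c3).2⟩
          have := hw y (by simp)
          omega
        simpa using this

lemma main (m n : ℕ) : ∃ f : List ℤ → List ℤ,
    (∀ a, Valid m a → a.length = n + 1 → (f a).length = n + 1 ∧ Valid m (f a) ∧
      (f a).sum = dinvL m a ∧
      (∀ u s w, a = u ++ w → Ins m u s w → ∀ z ∈ (f a).getLast?, T m u s w ≤ z + m)) ∧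
    (∀ a b, Valid m a → a.length = n + 1 → Valid m b → b.length = n + 1 → f a = f b → a = b) := by
  induction n with
  | zero =>
    refine ⟨id, ?_, fun a b _ _ _ _ h => h⟩
    intro a ha hl
    obtain ⟨x, rfl⟩ := List.length_eq_one_iff.1 hl
    have hx : x = 0 := by simpa using ha.1
    subst hx
    refine ⟨by simp, ha, by simp [dinvL], ?_⟩
    intro u s w he hi z hz
    simp at hz
    subst hz
    have hs : 0 ≤ s := by
      have : (0:ℤ) ∈ u ++ w := by rw [← he]; simp
      rcases List.mem_append.1 this with hh | hh
      · exact hi.2.1 _ hh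
      · exact (hi.2.2 _ hh).le
    have h1 := T_lt m u s w hi
    rw [← he] at h1
    simp [A] at h1
    omega
  | succ n ih =>
    obtain ⟨f, hf, hinj⟩ := ih
    have key : ∀ a : List ℤ, ∃ r : List ℤ × ℤ × List ℤ, Valid m a → a.length = n + 1 + 1 →
        a = r.1 ++ r.2.1 :: r.2.2 ∧ Ins m r.1 r.2.1 r.2.2 ∧ Valid m (r.1 ++ r.2.2) ∧
          (r.1 ++ r.2.2).length = n + 1 := by
      intro a
      by_cases h : Valid m a ∧ a.length = n + 1 + 1
      · obtain ⟨u, s, w, h1, h2, h3⟩ := decomp m a (by omega) h.1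
        refine ⟨(u, s, w), fun _ hl => ⟨h1, h2, h3, ?_⟩⟩
        subst h1
        simp at hl ⊢
        omega
      · exact ⟨([], 0, []), fun h1 h2 => absurd ⟨h1, h2⟩ h⟩
    choose r hr using key
    refine ⟨fun a => f ((r a).1 ++ (r a).2.2) ++ [T m (r a).1 (r a).2.1 (r a).2.2], ?_, ?_⟩
    · intro a ha hl
      obtain ⟨h1, h2, h3, h4⟩ := hr a ha hl
      obtain ⟨f1, ⟨f2, f2', f2''⟩, f3, f4⟩ := hf _ h3 h4
      refine ⟨by simp [f1], ⟨?_, ?_, ?_⟩, ?_, ?_⟩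
      · rw [List.head?_append, f2]; rfl
      · intro x hx
        rcases List.mem_append.1 hx with hx | hx
        · exact f2' _ hx
        · simp at hx
          subst hx
          exact T_nonneg _ _ _ _
      · rw [List.isChain_append]
        refine ⟨f2'', by simp, ?_⟩
        intro x hx y hy
        simp at hy
        subst hy
        exact f4 _ _ _ rfl h2 x hx
      · rw [List.sum_append, f3]
        conv_rhs => rw [h1, dinvL_T m _ _ _ h2.2.1 h2.2.2]
        simp
      · intro u s w he hi z hz
        simp at hz
        subst hz
        exact T_step m (h1.symm.trans he) h2 hi
    · intro a b ha hal hb hbl hab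
      obtain ⟨h1, h2, h3, h4⟩ := hr a ha hal
      obtain ⟨k1, k2, k3, k4⟩ := hr b hb hbl
      obtain ⟨e1, e2⟩ := List.append_inj' hab rfl
      have e3 := hinj _ _ h3 h4 k3 k4 e1
      simp at e2
      rw [h1, k1]
      exact T_inj m e3 h2 k2 e2

lemma dinv_ofFn (m n : ℕ) (a : Fin n → ℤ) : dinvm n m a = dinvL m (List.ofFn a) := by
  induction n with
  | zero => simp [dinvm, dinvL]
  | succ n ih =>
    rw [List.ofFn_succ, dinvL, ← ih]
    simp only [dinvm, Finset.sum_filter]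
    rw [Fin.sum_univ_succ]
    simp only [Fin.sum_univ_succ, List.map_ofFn, List.sum_ofFn]
    simp [Finset.sum_add_distrib]

lemma mem_iff (m n : ℕ) (hn : 1 ≤ n) (a : Fin n → ℤ) :
    (a ⟨0, by omega⟩ = 0 ∧ ∀ i : ℕ, ∀ hi : i + 1 < n,
        0 ≤ a ⟨i + 1, hi⟩ ∧ a ⟨i + 1, hi⟩ ≤ a ⟨i, by omega⟩ + (m : ℤ)) ↔
      Valid m (List.ofFn a) := by
  obtain ⟨n, rfl⟩ : ∃ k, n = k + 1 := ⟨n - 1, by omega⟩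
  unfold Valid
  rw [List.isChain_iff_getElem]
  simp only [List.ofFn_succ, List.head?_cons, Option.some.injEq]
  simp only [← List.ofFn_succ, List.getElem_ofFn, List.length_ofFn, List.mem_ofFn]
  constructor
  · rintro ⟨h0, h⟩
    refine ⟨h0, ?_, fun i hi => (h i hi).2⟩
    rintro x ⟨⟨i, hi⟩, rfl⟩
    cases i with
    | zero => exact h0.ge
    | succ i => exact (h i hi).1
  · rintro ⟨h0, h1, h2⟩
    exact ⟨h0, fun i hi => ⟨h1 _ ⟨_, rfl⟩, h2 i hi⟩⟩

end DA



/-- dinv and area have the same univariate distribution on m-Dyck paths. -/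
theorem dinv_area_equidistributed (m n : ℕ) (hm : 1 ≤ m) (hn : 1 ≤ n)
    (L : Finset (Fin n → ℤ))
    (hL : ∀ a : Fin n → ℤ, a ∈ L ↔
      (a ⟨0, by omega⟩ = 0 ∧ ∀ i : ℕ, ∀ hi : i + 1 < n,
        0 ≤ a ⟨i + 1, hi⟩ ∧ a ⟨i + 1, hi⟩ ≤ a ⟨i, by omega⟩ + (m : ℤ)))
    (k : ℕ) :
    (L.filter (fun a => dinvm n m a = (k : ℤ))).card =
      (L.filter (fun a => aream n a = (k : ℤ))).card := by
  obtain ⟨f, hf, hinj⟩ := DA.main m (n - 1)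
  have hn1 : n - 1 + 1 = n := by omega
  rw [hn1] at hf hinj
  have hL' : ∀ a : Fin n → ℤ, a ∈ L ↔ DA.Valid m (List.ofFn a) := fun a =>
    (hL a).trans (DA.mem_iff m n hn a)
  let g : (Fin n → ℤ) → (Fin n → ℤ) := fun a i => (f (List.ofFn a)).getD i 0
  have hg : ∀ a ∈ L, List.ofFn (g a) = f (List.ofFn a) := by
    intro a ha
    have h1 := (hf _ ((hL' a).1 ha) (by simp)).1
    apply List.ext_getElem
    · simp [h1]
    · intro i hi hi'
      simp [g, hi']
  have hmaps : ∀ a ∈ L, g a ∈ L := by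
    intro a ha
    rw [hL', hg a ha]
    exact (hf _ ((hL' a).1 ha) (by simp)).2.1
  have hginj : Set.InjOn g L := by
    intro a ha b hb hab
    apply List.ofFn_injective
    apply hinj _ _ ((hL' a).1 ha) (by simp) ((hL' b).1 hb) (by simp)
    rw [← hg a ha, ← hg b hb, hab]
  have hsum : ∀ a ∈ L, aream n (g a) = dinvm n m a := by
    intro a ha
    rw [DA.dinv_ofFn, ← (hf _ ((hL' a).1 ha) (by simp)).2.2.1, ← hg a ha, List.sum_ofFn, aream]
  have himg : L.image g = L := by
    apply Finset.eq_of_subset_of_card_le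
    · intro b hb
      obtain ⟨a, ha, rfl⟩ := Finset.mem_image.1 hb
      exact hmaps a ha
    · rw [Finset.card_image_of_injOn hginj]
  apply Finset.card_bij (fun a _ => g a)
  · intro a ha
    rw [Finset.mem_filter] at ha ⊢
    exact ⟨hmaps a ha.1, by rw [hsum a ha.1, ha.2]⟩
  · intro a ha b hb hab
    exact hginj (Finset.mem_filter.1 ha).1 (Finset.mem_filter.1 hb).1 hab
  · intro b hb
    rw [Finset.mem_filter] at hb
    have h1 := hb.1
    rw [← himg] at h1
    obtain ⟨a, ha, rfl⟩ := Finset.mem_image.1 h1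
    exact ⟨a, Finset.mem_filter.2 ⟨ha, by rw [← hsum a ha, hb.2]⟩, rfl⟩
end
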